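/- There exists μ* ∈ (0,∞) such that: (1) for all μ ∈ (0, μ*) one has m_{1,μ} < 2π·m̂_{1/√(2π)}, and every minimizer (u,v) of m_{1,μ} satisfies (u_y, v_y) ≠ (0,0); (2) for all μ ∈ (μ*, ∞) one has m_{1,μ} = 2π·m̂_{1/√(2π)}, and every minimizer (u,v) of m_{1,μ} satisfies u_y = 0 and v_y = 0. -/

import Mathlib

noncomputable section

open MeasureTheory Real Filter

namespace Waveguide

/-- A point of the waveguide `ℝ³ × 𝕋`, modelled as `ℝ³ × ℝ` with functions that are
`2π`-periodic in the second coordinate. -/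
abbrev Pt : Type := (Fin 3 → ℝ) × ℝ

/-- The fundamental domain `ℝ³ × (0, 2π]` of the waveguide `ℝ³ × 𝕋`. -/
def Dom : Set Pt := Set.univ ×ˢ Set.Ioc 0 (2 * π)

/-- `2π`-periodicity in the `y` variable. -/
def PeriodicY (u : Pt → ℝ) : Prop := ∀ x y, u (x, y + 2 * π) = u (x, y)

/-- The `i`-th horizontal coordinate direction. -/
def ex (i : Fin 3) : Pt := (fun j => if j = i then 1 else 0, 0)

/-- The vertical (periodic) direction. -/
def ey : Pt := (0, 1)

/-- `i`-th partial derivative in the `x` variables. -/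
def gradx (u : Pt → ℝ) (p : Pt) (i : Fin 3) : ℝ := fderiv ℝ u p (ex i)

/-- Partial derivative in the `y` variable, `u_y`. -/
def grady (u : Pt → ℝ) (p : Pt) : ℝ := fderiv ℝ u p ey

/-- `|∇_x u|²`. -/
def gradSqX (u : Pt → ℝ) (p : Pt) : ℝ := ∑ i, (gradx u p i) ^ 2

/-- `|∇_{x,y} u|²`. -/
def gradSq (u : Pt → ℝ) (p : Pt) : ℝ := gradSqX u p + (grady u p) ^ 2

/-- Membership in (a regular repesentative of) `H¹(ℝ³ × 𝕋)`, for real valued functions. -/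
structure H1 (u : Pt → ℝ) : Prop where
  periodic : PeriodicY u
  diff : Differentiable ℝ u
  memL2 : IntegrableOn (fun p => (u p) ^ 2) Dom
  memGrad : IntegrableOn (fun p => gradSq u p) Dom
  memL4 : IntegrableOn (fun p => (u p) ^ 4) Dom

/-- The `L²(ℝ³ × 𝕋)` norm. -/
def l2 (u : Pt → ℝ) : ℝ := Real.sqrt (∫ p in Dom, (u p) ^ 2)

/-- `u ∈ S_Θ`. -/
def inS (Θ : ℝ) (u : Pt → ℝ) : Prop := H1 u ∧ l2 u = Θ

/-- The nonlinear density `u⁴ + 2u²v² + v⁴`. -/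
def nonlin (u v : Pt → ℝ) (p : Pt) : ℝ :=
  (u p) ^ 4 + 2 * (u p) ^ 2 * (v p) ^ 2 + (v p) ^ 4

/-- The energy functional `I(u,v)`. -/
def energy (u v : Pt → ℝ) : ℝ :=
  (1 / 2) * (∫ p in Dom, (gradSq u p + gradSq v p))
    - (1 / 4) * ∫ p in Dom, nonlin u v p

/-- The semivirial functional `Q(u,v)`. -/
def svirial (u v : Pt → ℝ) : ℝ :=
  (∫ p in Dom, (gradSqX u p + gradSqX v p))
    - (3 / 4) * ∫ p in Dom, nonlin u v p

/-- The ground-state level `m_Θ`. -/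
def mlevel (Θ : ℝ) : ℝ :=
  sInf {c | ∃ u v : Pt → ℝ, inS Θ u ∧ inS Θ v ∧ svirial u v = 0 ∧ energy u v = c}

/-- `(u,v)` is a minimizer of `m_Θ`: it lies in `V_Θ` and attains the infimum. -/
def isMinimizer (Θ : ℝ) (u v : Pt → ℝ) : Prop :=
  inS Θ u ∧ inS Θ v ∧ svirial u v = 0 ∧ energy u v = mlevel Θ

/-- Smooth, compactly supported (in `x`) test function on the waveguide. -/
def TestFun (φ : Pt → ℝ) : Prop :=
  ContDiff ℝ (⊤ : ℕ∞) φ ∧ PeriodicY φ ∧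
    ∃ K : Set (Fin 3 → ℝ), IsCompact K ∧ ∀ p : Pt, p.1 ∉ K → φ p = 0

/-- `u` is a weak solution of `-Δ_{x,y} u + lam u = f` on `ℝ³ × 𝕋`. -/
def WeakSol (lam : ℝ) (u f : Pt → ℝ) : Prop :=
  ∀ φ : Pt → ℝ, TestFun φ →
    (∫ p in Dom,
        ((∑ i, gradx u p i * gradx φ p i) + grady u p * grady φ p + lam * u p * φ p))
      = ∫ p in Dom, f p * φ p

/-- The mass-preserving rescaling `u^τ(x,y) = τ^{3/2} u(τx, y)`. -/
def scaleX (τ : ℝ) (u : Pt → ℝ) : Pt → ℝ :=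
  fun p => τ ^ ((3 : ℝ) / 2) * u (τ • p.1, p.2)

/-- `u` is independent of the `y` variable, i.e. `u_y = 0` (a.e.). -/
def Yindep (u : Pt → ℝ) : Prop := ∀ᵐ p : Pt ∂volume, grady u p = 0

/-- The functional `J_μ(u,v)`. -/
def Jfun (μ : ℝ) (u v : Pt → ℝ) : ℝ :=
  (1 / 2) * (∫ p in Dom,
      (gradSqX u p + μ * (grady u p) ^ 2 + gradSqX v p + μ * (grady v p) ^ 2))
    - (1 / 4) * ∫ p in Dom, nonlin u v p

/-- The level `m_{1,μ}`. -/
def m1 (μ : ℝ) : ℝ :=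
  sInf {c | ∃ u v : Pt → ℝ, inS 1 u ∧ inS 1 v ∧ svirial u v = 0 ∧ Jfun μ u v = c}

/-- `(u,v)` is a minimizer of `m_{1,μ}`. -/
def isMinimizerJ (μ : ℝ) (u v : Pt → ℝ) : Prop :=
  inS 1 u ∧ inS 1 v ∧ svirial u v = 0 ∧ Jfun μ u v = m1 μ

/-! ### Objects on `ℝ³` -/

abbrev Pt3 : Type := Fin 3 → ℝ

def e3 (i : Fin 3) : Pt3 := fun j => if j = i then 1 else 0

def grad3 (w : Pt3 → ℝ) (x : Pt3) (i : Fin 3) : ℝ := fderiv ℝ w x (e3 i)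

def gradSq3 (w : Pt3 → ℝ) (x : Pt3) : ℝ := ∑ i, (grad3 w x i) ^ 2

/-- Membership in (a regular representative of) `H¹(ℝ³)`. -/
structure H1R3 (w : Pt3 → ℝ) : Prop where
  diff : Differentiable ℝ w
  memL2 : Integrable (fun x => (w x) ^ 2)
  memGrad : Integrable (fun x => gradSq3 w x)
  memL4 : Integrable (fun x => (w x) ^ 4)

/-- The `L²(ℝ³)` norm. -/
def l2R3 (w : Pt3 → ℝ) : ℝ := Real.sqrt (∫ x, (w x) ^ 2)

def nonlin3 (u v : Pt3 → ℝ) (x : Pt3) : ℝ :=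
  (u x) ^ 4 + 2 * (u x) ^ 2 * (v x) ^ 2 + (v x) ^ 4

/-- The limit energy `Î(u,v)` on `ℝ³`. -/
def Ihat (u v : Pt3 → ℝ) : ℝ :=
  (1 / 2) * (∫ x, (gradSq3 u x + gradSq3 v x)) - (1 / 4) * ∫ x, nonlin3 u v x

/-- The virial `Q̂(u,v)` on `ℝ³`. -/
def Qhat (u v : Pt3 → ℝ) : ℝ :=
  (∫ x, (gradSq3 u x + gradSq3 v x)) - (3 / 4) * ∫ x, nonlin3 u v x

/-- The ground-state energy `m̂_ρ` on `ℝ³`. -/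
def mhat (ρ : ℝ) : ℝ :=
  sInf {c | ∃ u v : Pt3 → ℝ, H1R3 u ∧ H1R3 v ∧ l2R3 u = ρ ∧ l2R3 v = ρ ∧
    Qhat u v = 0 ∧ Ihat u v = c}

open scoped ENNReal NNReal Topology

lemma volume_restrict_dom :
    (volume : Measure Pt).restrict Dom
      = (volume : Measure Pt3).prod (volume.restrict (Set.Ioc (0 : ℝ) (2 * π))) := by
  rw [Dom, Measure.volume_eq_prod, ← Measure.prod_restrict, Measure.restrict_univ]

lemma sq_norm_clm_le (T : Pt3 →L[ℝ] ℝ) : ‖T‖ ^ 2 ≤ 3 * ∑ i, (T (e3 i)) ^ 2 := by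
  have h1 : ‖T‖ ≤ ∑ i, |T (e3 i)| := by
    refine T.opNorm_le_bound (Finset.sum_nonneg fun i _ => abs_nonneg _) fun x => ?_
    have hx : T x = ∑ i, x i * T (e3 i) := by
      have := T.toLinearMap.pi_apply_eq_sum_univ x
      simp only [ContinuousLinearMap.coe_coe, smul_eq_mul] at this
      rw [this]
      refine Finset.sum_congr rfl fun i _ => ?_
      congr 2
      ext j
      simp [e3, eq_comm]
    rw [hx, Finset.sum_mul]
    refine (norm_sum_le _ _).trans (Finset.sum_le_sum fun i _ => ?_)
    rw [norm_mul, mul_comm, Real.norm_eq_abs (T (e3 i))]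
    gcongr
    exact norm_le_pi_norm x i
  have h2 : (∑ i, |T (e3 i)|) ^ 2 ≤ 3 * ∑ i, (T (e3 i)) ^ 2 := by
    have := sq_sum_le_card_mul_sum_sq (s := (Finset.univ : Finset (Fin 3)))
      (f := fun i => |T (e3 i)|)
    simpa using this
  calc ‖T‖ ^ 2 ≤ (∑ i, |T (e3 i)|) ^ 2 := by gcongr
    _ ≤ _ := h2

lemma gradSq3_nonneg (f : Pt3 → ℝ) (x : Pt3) : 0 ≤ gradSq3 f x :=
  Finset.sum_nonneg fun _ _ => sq_nonneg _

lemma gradSqX_nonneg (u : Pt → ℝ) (p : Pt) : 0 ≤ gradSqX u p :=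
  Finset.sum_nonneg fun _ _ => sq_nonneg _

/-- The Sobolev inequality `‖f‖₆ ≤ C ‖∇f‖₂` on `ℝ³`. -/
lemma exists_sobolev_six : ∃ C : ℝ≥0, ∀ f : Pt3 → ℝ, ContDiff ℝ 1 f → HasCompactSupport f →
    (∫⁻ x, ‖f x‖ₑ ^ 6) ≤ C * (∫⁻ x, ENNReal.ofReal (gradSq3 f x)) ^ 3 := by
  set C₀ := SNormLESNormFDerivOfEqConst ℝ (volume : Measure Pt3) ((2 : ℝ≥0) : ℝ) with hC₀
  refine ⟨C₀ ^ 6 * 27, fun f hf hc => ?_⟩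
  have key := eLpNorm_le_eLpNorm_fderiv_of_eq (volume : Measure Pt3) hf hc
    (p := 2) (p' := 6) (by norm_num) (by simp) (by simp; norm_num)
  have h6 : ∫⁻ x, ‖f x‖ₑ ^ 6 = eLpNorm f ((6 : ℝ≥0) : ℝ≥0∞) volume ^ 6 := by
    have := eLpNorm_nnreal_pow_eq_lintegral (f := f) (μ := (volume : Measure Pt3)) (p := 6)
      (by norm_num)
    rw [← ENNReal.rpow_natCast]
    simpa using this.symm
  have h2 : eLpNorm (fderiv ℝ f) ((2 : ℝ≥0) : ℝ≥0∞) volume ^ 2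
      ≤ 3 * ∫⁻ x, ENNReal.ofReal (gradSq3 f x) := by
    have := eLpNorm_nnreal_pow_eq_lintegral (f := fderiv ℝ f) (μ := (volume : Measure Pt3))
      (p := 2) (by norm_num)
    have h3 : eLpNorm (fderiv ℝ f) ((2 : ℝ≥0) : ℝ≥0∞) volume ^ 2
        = ∫⁻ x, ‖fderiv ℝ f x‖ₑ ^ 2 := by
      rw [← ENNReal.rpow_natCast]
      simpa using this
    rw [h3, ← lintegral_const_mul' _ _ (by simp)]
    refine lintegral_mono fun x => ?_
    rw [← ofReal_norm, ← ENNReal.ofReal_pow (norm_nonneg _),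
      show (3 : ℝ≥0∞) = ENNReal.ofReal 3 by simp, ← ENNReal.ofReal_mul (by norm_num)]
    exact ENNReal.ofReal_le_ofReal (sq_norm_clm_le _)
  rw [h6]
  calc eLpNorm f ((6 : ℝ≥0) : ℝ≥0∞) volume ^ 6
      ≤ (C₀ * eLpNorm (fderiv ℝ f) ((2 : ℝ≥0) : ℝ≥0∞) volume) ^ 6 := by gcongr
    _ = C₀ ^ 6 * (eLpNorm (fderiv ℝ f) ((2 : ℝ≥0) : ℝ≥0∞) volume ^ 2) ^ 3 := by
        rw [mul_pow, ← pow_mul]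
    _ ≤ C₀ ^ 6 * (3 * ∫⁻ x, ENNReal.ofReal (gradSq3 f x)) ^ 3 := by gcongr
    _ = _ := by
        rw [mul_pow]; push_cast; ring

/-- Continuously differentiable functions on the waveguide with bounded support in `x`. -/
structure Nice (u : Pt → ℝ) : Prop where
  contDiff : ContDiff ℝ 1 u
  periodic : PeriodicY u
  bounded : ∃ R : ℝ, ∀ p : Pt, R < ‖p.1‖ → u p = 0

lemma hasFDerivAt_slice_x {u : Pt → ℝ} (hu : Differentiable ℝ u) (x : Pt3) (y : ℝ) :
    HasFDerivAt (fun x' => u (x', y))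
      ((fderiv ℝ u (x, y)).comp (ContinuousLinearMap.inl ℝ Pt3 ℝ)) x :=
  (hu (x, y)).hasFDerivAt.comp x (hasFDerivAt_prodMk_left x y)

lemma hasDerivAt_slice_y {u : Pt → ℝ} (hu : Differentiable ℝ u) (x : Pt3) (y : ℝ) :
    HasDerivAt (fun y' => u (x, y')) (grady u (x, y)) y := by
  have h := (hu (x, y)).hasFDerivAt.comp y (hasFDerivAt_prodMk_right x y)
  have h' := h.hasDerivAt
  simpa [grady, ey, Function.comp_def] using h'

lemma gradSq3_slice {u : Pt → ℝ} (hu : Differentiable ℝ u) (x : Pt3) (y : ℝ) :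
    gradSq3 (fun x' => u (x', y)) x = gradSqX u (x, y) := by
  unfold gradSq3 gradSqX grad3 gradx
  rw [(hasFDerivAt_slice_x hu x y).fderiv]
  rfl

lemma Nice.slice_contDiff {u : Pt → ℝ} (hu : Nice u) (y : ℝ) :
    ContDiff ℝ 1 (fun x => u (x, y)) :=
  hu.contDiff.comp (contDiff_id.prodMk contDiff_const)

lemma hasCompactSupport_of_bounded {f : Pt3 → ℝ} {R : ℝ} (h : ∀ x, R < ‖x‖ → f x = 0) :
    HasCompactSupport f :=
  HasCompactSupport.intro (isCompact_closedBall (0 : Pt3) R) fun x hx =>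
    h x (by simpa using hx)

lemma Nice.slice_hasCompactSupport {u : Pt → ℝ} (hu : Nice u) (y : ℝ) :
    HasCompactSupport (fun x => u (x, y)) := by
  obtain ⟨R, hR⟩ := hu.bounded
  exact hasCompactSupport_of_bounded (R := R) fun x hx => hR (x, y) hx

lemma Nice.differentiable {u : Pt → ℝ} (hu : Nice u) : Differentiable ℝ u :=
  hu.contDiff.differentiable one_ne_zero

lemma Nice.continuous {u : Pt → ℝ} (hu : Nice u) : Continuous u := hu.contDiff.continuous

lemma Nice.continuous_gradx {u : Pt → ℝ} (hu : Nice u) (i : Fin 3) :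
    Continuous fun p => gradx u p i :=
  (hu.contDiff.continuous_fderiv one_ne_zero).clm_apply continuous_const

lemma Nice.continuous_grady {u : Pt → ℝ} (hu : Nice u) : Continuous (grady u) :=
  (hu.contDiff.continuous_fderiv one_ne_zero).clm_apply continuous_const

lemma Nice.continuous_gradSqX {u : Pt → ℝ} (hu : Nice u) : Continuous (gradSqX u) :=
  continuous_finsetSum _ fun i _ => (hu.continuous_gradx i).pow 2

/-- A mean-zero function on the circle satisfies `|w|² ≤ 2 ∫ |w| |w_y|`. -/
lemma Nice.enorm_sq_le {w : Pt → ℝ} (hw : Nice w) (x : Pt3)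
    (h0 : ∫ y in (0 : ℝ)..(2 * π), w (x, y) = 0) {y : ℝ} (hy : y ∈ Set.Ioc (0 : ℝ) (2 * π)) :
    ‖w (x, y)‖ₑ ^ 2
      ≤ 2 * ∫⁻ t in Set.Ioc (0 : ℝ) (2 * π), ‖w (x, t)‖ₑ * ‖grady w (x, t)‖ₑ := by
  have hcont : Continuous fun t => w (x, t) := hw.continuous.comp (by fun_prop)
  have hcont' : Continuous fun t => grady w (x, t) := hw.continuous_grady.comp (by fun_prop)
  obtain ⟨z, hz, hz0⟩ : ∃ z ∈ Set.Ioc (0 : ℝ) (2 * π), w (x, z) = 0 := by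
    by_contra! hne
    have hpos : (0 : ℝ) < 2 * π := by positivity
    obtain ⟨c, hc, hc'⟩ := exists_hasDerivAt_eq_slope (fun t => ∫ s in (0 : ℝ)..t, w (x, s))
      (fun t => w (x, t)) hpos
      (intervalIntegral.continuous_primitive
        (fun a b => hcont.intervalIntegrable a b) 0).continuousOn
      (fun t _ => intervalIntegral.integral_hasDerivAt_right (hcont.intervalIntegrable _ _)
        (hcont.stronglyMeasurableAtFilter _ _) hcont.continuousAt)
    rw [h0] at hc'
    simp at hc'
    exact hne c ⟨hc.1, hc.2.le⟩ hc'
  have hftc : ∫ t in z..y, 2 * (w (x, t) * grady w (x, t)) = w (x, y) ^ 2 := by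
    have hI : Continuous fun t => 2 * (w (x, t) * grady w (x, t)) :=
      continuous_const.mul (hcont.mul hcont')
    rw [intervalIntegral.integral_eq_sub_of_hasDerivAt (f := fun t => w (x, t) ^ 2)
      (fun t _ => ((hasDerivAt_slice_y hw.differentiable x t).pow 2).congr_deriv
        (by push_cast; ring)) (hI.intervalIntegrable _ _)]
    simp [hz0]
  have hsub : Set.uIoc z y ⊆ Set.Ioc 0 (2 * π) := by
    intro t ht
    rw [Set.mem_uIoc] at ht
    rcases ht with ht | ht
    · exact ⟨hz.1.trans ht.1, ht.2.trans hy.2⟩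
    · exact ⟨hy.1.trans ht.1, ht.2.trans hz.2⟩
  calc ‖w (x, y)‖ₑ ^ 2 = ‖∫ t in z..y, 2 * (w (x, t) * grady w (x, t))‖ₑ := by
        rw [hftc, enorm_pow]
    _ ≤ ∫⁻ t in Set.uIoc z y, ‖2 * (w (x, t) * grady w (x, t))‖ₑ := by
        rw [← ofReal_norm, intervalIntegral.norm_intervalIntegral_eq,
          ofReal_norm]
        exact enorm_integral_le_lintegral_enorm _
    _ ≤ ∫⁻ t in Set.Ioc (0 : ℝ) (2 * π), ‖2 * (w (x, t) * grady w (x, t))‖ₑ :=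
        lintegral_mono_set hsub
    _ = _ := by
        rw [← lintegral_const_mul' _ _ (by simp)]
        refine lintegral_congr fun t => ?_
        rw [enorm_mul, enorm_mul]
        congr 1
        rw [← ofReal_norm]; simp

lemma lintegral_cauchy_schwarz {α : Type*} [MeasurableSpace α] (μ : Measure α) {f g : α → ℝ≥0∞}
    (hf : AEMeasurable f μ) (hg : AEMeasurable g μ) :
    ∫⁻ a, f a * g a ∂μ ≤ (∫⁻ a, f a ^ 2 ∂μ) ^ (1 / 2 : ℝ) * (∫⁻ a, g a ^ 2 ∂μ) ^ (1 / 2 : ℝ) := by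
  have := ENNReal.lintegral_mul_le_Lp_mul_Lq μ Real.HolderConjugate.two_two hf hg
  simpa using this

lemma lintegral_holder_six {α : Type*} [MeasurableSpace α] (μ : Measure α) {f g h : α → ℝ≥0∞}
    (hf : AEMeasurable f μ) (hg : AEMeasurable g μ) (hh : AEMeasurable h μ) :
    ∫⁻ a, f a ^ 2 * (g a * h a) ∂μ ≤ (∫⁻ a, f a ^ 6 ∂μ) ^ (1 / 3 : ℝ)
      * ((∫⁻ a, g a ^ 6 ∂μ) ^ (1 / 6 : ℝ) * (∫⁻ a, h a ^ 2 ∂μ) ^ (1 / 2 : ℝ)) := by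
  have h1 : ∫⁻ a, f a ^ 2 * (g a * h a) ∂μ
      ≤ (∫⁻ a, (f a ^ 2 * g a) ^ 2 ∂μ) ^ (1 / 2 : ℝ) * (∫⁻ a, h a ^ 2 ∂μ) ^ (1 / 2 : ℝ) := by
    simp_rw [← mul_assoc]
    exact lintegral_cauchy_schwarz μ ((hf.pow_const 2).mul hg) hh
  have h2 : ∫⁻ a, (f a ^ 2 * g a) ^ 2 ∂μ
      ≤ (∫⁻ a, f a ^ 6 ∂μ) ^ (2 / 3 : ℝ) * (∫⁻ a, g a ^ 6 ∂μ) ^ (1 / 3 : ℝ) := by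
    have := ENNReal.lintegral_mul_le_Lp_mul_Lq μ (p := 3 / 2) (q := 3)
      (Real.holderConjugate_iff.2 ⟨by norm_num, by norm_num⟩) (hf.pow_const 4) (hg.pow_const 2)
    convert this using 3
    · simp only [Pi.mul_apply]; ring
    · refine lintegral_congr fun a => ?_
      rw [← ENNReal.rpow_natCast, ← ENNReal.rpow_natCast, ← ENNReal.rpow_mul]
      norm_num
    · norm_num
    · refine lintegral_congr fun a => ?_
      rw [← ENNReal.rpow_natCast, ← ENNReal.rpow_natCast, ← ENNReal.rpow_mul]
      norm_num
  calc _ ≤ _ := h1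
    _ ≤ ((∫⁻ a, f a ^ 6 ∂μ) ^ (2 / 3 : ℝ) * (∫⁻ a, g a ^ 6 ∂μ) ^ (1 / 3 : ℝ)) ^ (1 / 2 : ℝ)
        * (∫⁻ a, h a ^ 2 ∂μ) ^ (1 / 2 : ℝ) := by gcongr
    _ = _ := by
        rw [ENNReal.mul_rpow_of_nonneg _ _ (by norm_num), ← ENNReal.rpow_mul, ← ENNReal.rpow_mul,
          mul_assoc]
        norm_num

/-- The extended-real-valued Dirichlet integral in the `x` variables. -/
def dirX (u : Pt → ℝ) : ℝ≥0∞ := ∫⁻ p in Dom, ENNReal.ofReal (gradSqX u p)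

/-- The extended-real-valued Dirichlet integral in the `y` variable. -/
def dirY (u : Pt → ℝ) : ℝ≥0∞ := ∫⁻ p in Dom, ENNReal.ofReal (grady u p ^ 2)

lemma lintegral_dom_symm {F : Pt → ℝ≥0∞} (hF : Measurable F) :
    ∫⁻ p in Dom, F p = ∫⁻ y in Set.Ioc (0 : ℝ) (2 * π), ∫⁻ x : Pt3, F (x, y) := by
  rw [volume_restrict_dom, lintegral_prod_symm' _ hF]

lemma lintegral_dom {F : Pt → ℝ≥0∞} (hF : Measurable F) :
    ∫⁻ p in Dom, F p = ∫⁻ x : Pt3, ∫⁻ y in Set.Ioc (0 : ℝ) (2 * π), F (x, y) := by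
  rw [volume_restrict_dom, lintegral_prod _ hF.aemeasurable]

lemma Nice.sobolev_slice {C : ℝ≥0}
    (hC : ∀ f : Pt3 → ℝ, ContDiff ℝ 1 f → HasCompactSupport f →
      (∫⁻ x, ‖f x‖ₑ ^ 6) ≤ C * (∫⁻ x, ENNReal.ofReal (gradSq3 f x)) ^ 3)
    {g : Pt → ℝ} (hg : Nice g) (y : ℝ) :
    ∫⁻ x : Pt3, ‖g (x, y)‖ₑ ^ 6
      ≤ C * (∫⁻ x : Pt3, ENNReal.ofReal (gradSqX g (x, y))) ^ 3 := by
  have := hC _ (hg.slice_contDiff y) (hg.slice_hasCompactSupport y)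
  simpa only [gradSq3_slice hg.differentiable] using this

/-- Interaction estimate: `∫ g² w² ≤ C ‖∇ₓ g‖² ‖∇ₓ w‖ ‖w_y‖` whenever `w` has zero mean in `y`. -/
lemma exists_interaction : ∃ C : ℝ≥0, ∀ g w : Pt → ℝ, Nice g → Nice w →
    (∀ x, ∫ y in (0 : ℝ)..(2 * π), w (x, y) = 0) →
    ∫⁻ p in Dom, ‖g p‖ₑ ^ 2 * ‖w p‖ₑ ^ 2
      ≤ C * (dirX g * (dirX w ^ (1 / 2 : ℝ) * dirY w ^ (1 / 2 : ℝ))) := by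
  obtain ⟨C, hC⟩ := exists_sobolev_six
  refine ⟨2 * (C ^ (1 / 3 : ℝ) * C ^ (1 / 6 : ℝ)), fun g w hg hw h0 => ?_⟩
  have hgm : Measurable fun p : Pt => ‖g p‖ₑ := hg.continuous.measurable.enorm
  have hwm : Measurable fun p : Pt => ‖w p‖ₑ := hw.continuous.measurable.enorm
  have hwym : Measurable fun p : Pt => ‖grady w p‖ₑ := hw.continuous_grady.measurable.enorm
  have hGX : Measurable fun p : Pt => ENNReal.ofReal (gradSqX g p) :=
    hg.continuous_gradSqX.measurable.ennreal_ofReal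
  have hWX : Measurable fun p : Pt => ENNReal.ofReal (gradSqX w p) :=
    hw.continuous_gradSqX.measurable.ennreal_ofReal
  have hWY : Measurable fun p : Pt => ENNReal.ofReal (grady w p ^ 2) :=
    (hw.continuous_grady.pow 2).measurable.ennreal_ofReal
  set I := Set.Ioc (0 : ℝ) (2 * π) with hI
  have hsl : ∀ y : ℝ, Measurable fun x : Pt3 => (x, y) := fun y => by fun_prop
  set X : ℝ → ℝ≥0∞ := fun y => ∫⁻ x : Pt3, ENNReal.ofReal (gradSqX g (x, y)) with hX
  set Y : ℝ → ℝ≥0∞ := fun y => ∫⁻ x : Pt3, ENNReal.ofReal (gradSqX w (x, y)) with hY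
  set Z : ℝ → ℝ≥0∞ := fun y => ∫⁻ x : Pt3, ENNReal.ofReal (grady w (x, y) ^ 2) with hZ
  have hXm : Measurable X := hGX.lintegral_prod_left'
  have hYm : Measurable Y := hWX.lintegral_prod_left'
  have hZm : Measurable Z := hWY.lintegral_prod_left'
  have hslice : ∀ y t : ℝ, ∫⁻ x : Pt3, ‖g (x, y)‖ₑ ^ 2 * (‖w (x, t)‖ₑ * ‖grady w (x, t)‖ₑ)
      ≤ (C ^ (1 / 3 : ℝ) * X y) * (C ^ (1 / 6 : ℝ) * (Y t ^ (1 / 2 : ℝ) * Z t ^ (1 / 2 : ℝ))) := by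
    intro y t
    have h := lintegral_holder_six (volume : Measure Pt3)
      (hgm.comp (hsl y)).aemeasurable (hwm.comp (hsl t)).aemeasurable
      (hwym.comp (hsl t)).aemeasurable
    refine h.trans ?_
    have e1 : (∫⁻ x : Pt3, ‖g (x, y)‖ₑ ^ 6) ^ (1 / 3 : ℝ) ≤ C ^ (1 / 3 : ℝ) * X y := by
      calc _ ≤ (C * X y ^ 3) ^ (1 / 3 : ℝ) := by gcongr; exact hg.sobolev_slice hC y
        _ = _ := by
          rw [ENNReal.mul_rpow_of_nonneg _ _ (by norm_num), ← ENNReal.rpow_natCast,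
            ← ENNReal.rpow_mul]
          norm_num
    have e2 : (∫⁻ x : Pt3, ‖w (x, t)‖ₑ ^ 6) ^ (1 / 6 : ℝ)
        ≤ C ^ (1 / 6 : ℝ) * Y t ^ (1 / 2 : ℝ) := by
      calc _ ≤ (C * Y t ^ 3) ^ (1 / 6 : ℝ) := by gcongr; exact hw.sobolev_slice hC t
        _ = _ := by
          rw [ENNReal.mul_rpow_of_nonneg _ _ (by norm_num), ← ENNReal.rpow_natCast,
            ← ENNReal.rpow_mul]
          norm_num
    have e3 : ∫⁻ x : Pt3, ‖grady w (x, t)‖ₑ ^ 2 = Z t := by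
      refine lintegral_congr fun x => ?_
      rw [← ofReal_norm, ← ENNReal.ofReal_pow (norm_nonneg _)]
      simp
    calc _ ≤ (C ^ (1 / 3 : ℝ) * X y) * ((C ^ (1 / 6 : ℝ) * Y t ^ (1 / 2 : ℝ))
          * Z t ^ (1 / 2 : ℝ)) := by
          rw [← e3]; exact mul_le_mul' e1 (mul_le_mul' e2 le_rfl)
      _ = _ := by rw [mul_assoc (_ ^ (1 / 6 : ℝ))]
  have hfub : ∀ y : ℝ, ∫⁻ x : Pt3, ‖g (x, y)‖ₑ ^ 2
        * (2 * ∫⁻ t in I, ‖w (x, t)‖ₑ * ‖grady w (x, t)‖ₑ)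
      = 2 * ∫⁻ t in I, ∫⁻ x : Pt3, ‖g (x, y)‖ₑ ^ 2 * (‖w (x, t)‖ₑ * ‖grady w (x, t)‖ₑ) := by
    intro y
    have hmeas : Measurable fun p : Pt => ‖g (p.1, y)‖ₑ ^ 2 * (‖w p‖ₑ * ‖grady w p‖ₑ) :=
      ((hgm.comp (by fun_prop : Measurable fun p : Pt => (p.1, y))).pow_const 2).mul (hwm.mul hwym)
    rw [← lintegral_dom_symm hmeas, lintegral_dom hmeas, ← lintegral_const_mul' _ _ (by simp)]
    refine lintegral_congr fun x => ?_
    rw [mul_left_comm, ← lintegral_const_mul' (‖g (x, y)‖ₑ ^ 2) _ (by simp)]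
  have hmean : ∀ y ∈ I, ∀ x, ‖w (x, y)‖ₑ ^ 2
      ≤ 2 * ∫⁻ t in I, ‖w (x, t)‖ₑ * ‖grady w (x, t)‖ₑ :=
    fun y hy x => hw.enorm_sq_le x (h0 x) hy
  calc ∫⁻ p in Dom, ‖g p‖ₑ ^ 2 * ‖w p‖ₑ ^ 2
      = ∫⁻ y in I, ∫⁻ x : Pt3, ‖g (x, y)‖ₑ ^ 2 * ‖w (x, y)‖ₑ ^ 2 :=
        lintegral_dom_symm ((hgm.pow_const 2).mul (hwm.pow_const 2))
    _ ≤ ∫⁻ y in I, 2 * ∫⁻ t in I,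
          (C ^ (1 / 3 : ℝ) * X y) * (C ^ (1 / 6 : ℝ) * (Y t ^ (1 / 2 : ℝ) * Z t ^ (1 / 2 : ℝ))) := by
        refine setLIntegral_mono' measurableSet_Ioc fun y hy => ?_
        calc _ ≤ ∫⁻ x : Pt3, ‖g (x, y)‖ₑ ^ 2
              * (2 * ∫⁻ t in I, ‖w (x, t)‖ₑ * ‖grady w (x, t)‖ₑ) :=
              lintegral_mono fun x => mul_le_mul' le_rfl (hmean y hy x)
          _ = _ := hfub y
          _ ≤ _ := mul_le_mul' le_rfl (lintegral_mono fun t => hslice y t)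
    _ = 2 * (C ^ (1 / 3 : ℝ) * C ^ (1 / 6 : ℝ)) * ((∫⁻ y in I, X y)
          * ∫⁻ t in I, Y t ^ (1 / 2 : ℝ) * Z t ^ (1 / 2 : ℝ)) := by
        have hm : Measurable fun t => Y t ^ (1 / 2 : ℝ) * Z t ^ (1 / 2 : ℝ) :=
          (hYm.pow_const _).mul (hZm.pow_const _)
        have : ∀ y, 2 * ∫⁻ t in I, (C ^ (1 / 3 : ℝ) * X y)
            * (C ^ (1 / 6 : ℝ) * (Y t ^ (1 / 2 : ℝ) * Z t ^ (1 / 2 : ℝ)))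
            = X y * (2 * (C ^ (1 / 3 : ℝ) * C ^ (1 / 6 : ℝ))
              * ∫⁻ t in I, Y t ^ (1 / 2 : ℝ) * Z t ^ (1 / 2 : ℝ)) := by
          intro y
          rw [lintegral_const_mul _ (hm.const_mul _), lintegral_const_mul _ hm]
          ring
        simp_rw [this]
        rw [lintegral_mul_const _ hXm]
        ring
    _ ≤ 2 * (C ^ (1 / 3 : ℝ) * C ^ (1 / 6 : ℝ)) * ((∫⁻ y in I, X y)
          * ((∫⁻ t in I, Y t) ^ (1 / 2 : ℝ) * (∫⁻ t in I, Z t) ^ (1 / 2 : ℝ))) := by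
        gcongr
        have := lintegral_cauchy_schwarz (volume.restrict I) (f := fun t => Y t ^ (1 / 2 : ℝ))
          (g := fun t => Z t ^ (1 / 2 : ℝ)) (hYm.pow_const _).aemeasurable
          (hZm.pow_const _).aemeasurable
        refine this.trans (le_of_eq ?_)
        congr 2 <;>
        · refine lintegral_congr fun t => ?_
          rw [← ENNReal.rpow_natCast, ← ENNReal.rpow_mul]
          norm_num
    _ = _ := by
        rw [dirX, dirX, dirY, lintegral_dom_symm hGX, lintegral_dom_symm hWX,
          lintegral_dom_symm hWY]
        push_cast
        rw [ENNReal.coe_rpow_of_nonneg _ (by norm_num), ENNReal.coe_rpow_of_nonneg _ (by norm_num)]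

/-- The average over the circle variable. -/
def avg (u : Pt → ℝ) (x : Pt3) : ℝ := (2 * π)⁻¹ * ∫ y in (0 : ℝ)..(2 * π), u (x, y)

/-- A function on `ℝ³` seen as a `y`-independent function on the waveguide. -/
def lift (f : Pt3 → ℝ) (p : Pt) : ℝ := f p.1

lemma Nice.hasFDerivAt_avg {u : Pt → ℝ} (hu : Nice u) (x : Pt3) :
    HasFDerivAt (avg u) ((2 * π)⁻¹ • ∫ y in (0 : ℝ)..(2 * π),
      (fderiv ℝ u (x, y)).comp (ContinuousLinearMap.inl ℝ Pt3 ℝ)) x := by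
  have hF' : Continuous fun p : Pt =>
      (fderiv ℝ u p).comp (ContinuousLinearMap.inl ℝ Pt3 ℝ) :=
    (hu.contDiff.continuous_fderiv one_ne_zero).clm_comp continuous_const
  obtain ⟨K, hK⟩ := ((isCompact_closedBall x 1).prod
    (isCompact_Icc (a := (0 : ℝ)) (b := 2 * π))).exists_bound_of_continuousOn hF'.continuousOn
  have hc : ∀ x' : Pt3, Continuous fun y => u (x', y) := fun x' =>
    hu.continuous.comp (by fun_prop)
  refine HasFDerivAt.const_mul ?_ _
  refine (intervalIntegral.hasFDerivAt_integral_of_dominated_of_fderiv_le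
    (F := fun x' y => u (x', y))
    (F' := fun x' y => (fderiv ℝ u (x', y)).comp (ContinuousLinearMap.inl ℝ Pt3 ℝ))
    (bound := fun _ => K) (Metric.closedBall_mem_nhds x one_pos)
    (Eventually.of_forall fun x' => (hc x').aestronglyMeasurable)
    ((hc x).intervalIntegrable _ _)
    (hF'.comp (by fun_prop : Continuous fun y : ℝ => (x, y))).aestronglyMeasurable
    (ae_of_all _ fun y hy x' hx' => hK (x', y) ⟨hx', ?_⟩)
    (by simp) (ae_of_all _ fun y _ x' _ => hasFDerivAt_slice_x hu.differentiable x' y))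
  rw [Set.uIoc_of_le (by positivity)] at hy
  exact Set.Ioc_subset_Icc_self hy

lemma Nice.contDiff_avg {u : Pt → ℝ} (hu : Nice u) : ContDiff ℝ 1 (avg u) := by
  rw [contDiff_one_iff_fderiv]
  refine ⟨fun x => (hu.hasFDerivAt_avg x).differentiableAt, ?_⟩
  rw [funext fun x => (hu.hasFDerivAt_avg x).fderiv]
  have h : Continuous fun x : Pt3 => ∫ y in (0 : ℝ)..(2 * π),
      (fderiv ℝ u (x, y)).comp (ContinuousLinearMap.inl ℝ Pt3 ℝ) := by
    refine intervalIntegral.continuous_parametric_intervalIntegral_of_continuous' ?_ _ _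
    exact (hu.contDiff.continuous_fderiv one_ne_zero).clm_comp continuous_const
  exact h.const_smul ((2 * π)⁻¹ : ℝ)

lemma Nice.grad3_avg {u : Pt → ℝ} (hu : Nice u) (x : Pt3) (i : Fin 3) :
    grad3 (avg u) x i = (2 * π)⁻¹ * ∫ y in (0 : ℝ)..(2 * π), gradx u (x, y) i := by
  have hF' : Continuous fun y : ℝ =>
      (fderiv ℝ u (x, y)).comp (ContinuousLinearMap.inl ℝ Pt3 ℝ) :=
    ((hu.contDiff.continuous_fderiv one_ne_zero).comp
      (by fun_prop : Continuous fun y : ℝ => (x, y))).clm_comp continuous_const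
  rw [grad3, (hu.hasFDerivAt_avg x).fderiv, smul_apply,
    ContinuousLinearMap.intervalIntegral_apply (hF'.intervalIntegrable _ _), smul_eq_mul]
  rfl

lemma lift_nice {f : Pt3 → ℝ} (hf : ContDiff ℝ 1 f) {R : ℝ} (hR : ∀ x, R < ‖x‖ → f x = 0) :
    Nice (lift f) :=
  ⟨hf.comp contDiff_fst, fun _ _ => rfl, R, fun p hp => hR p.1 hp⟩

lemma Nice.avg_bounded {u : Pt → ℝ} (hu : Nice u) : ∃ R : ℝ, ∀ x, R < ‖x‖ → avg u x = 0 := by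
  obtain ⟨R, hR⟩ := hu.bounded
  exact ⟨R, fun x hx => by simp [avg, fun y => hR (x, y) hx]⟩

lemma Nice.lift_avg {u : Pt → ℝ} (hu : Nice u) : Nice (lift (avg u)) := by
  obtain ⟨R, hR⟩ := hu.avg_bounded
  exact lift_nice hu.contDiff_avg hR

lemma Nice.sub {u v : Pt → ℝ} (hu : Nice u) (hv : Nice v) : Nice (fun p => u p - v p) := by
  obtain ⟨R, hR⟩ := hu.bounded
  obtain ⟨S, hS⟩ := hv.bounded
  refine ⟨hu.contDiff.sub hv.contDiff, fun x y => ?_, max R S, fun p hp => ?_⟩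
  · simp only [hu.periodic x y, hv.periodic x y]
  · simp [hR p ((le_max_left _ _).trans_lt hp), hS p ((le_max_right _ _).trans_lt hp)]

lemma hasFDerivAt_lift {f : Pt3 → ℝ} {p : Pt} (hf : DifferentiableAt ℝ f p.1) :
    HasFDerivAt (lift f) ((fderiv ℝ f p.1).comp (ContinuousLinearMap.fst ℝ Pt3 ℝ)) p :=
  hf.hasFDerivAt.comp p hasFDerivAt_fst

lemma gradx_lift {f : Pt3 → ℝ} {p : Pt} (hf : DifferentiableAt ℝ f p.1) (i : Fin 3) :
    gradx (lift f) p i = grad3 f p.1 i := by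
  rw [gradx, (hasFDerivAt_lift hf).fderiv]; rfl

lemma grady_lift {f : Pt3 → ℝ} {p : Pt} (hf : DifferentiableAt ℝ f p.1) :
    grady (lift f) p = 0 := by
  rw [grady, (hasFDerivAt_lift hf).fderiv]
  simp [ey]

lemma gradSqX_lift {f : Pt3 → ℝ} {p : Pt} (hf : DifferentiableAt ℝ f p.1) :
    gradSqX (lift f) p = gradSq3 f p.1 := by
  simp only [gradSqX, gradSq3, gradx_lift hf]

lemma gradx_sub {u v : Pt → ℝ} (hu : Differentiable ℝ u) (hv : Differentiable ℝ v) (p : Pt)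
    (i : Fin 3) : gradx (fun p => u p - v p) p i = gradx u p i - gradx v p i := by
  simp only [gradx]
  rw [fderiv_fun_sub (hu p) (hv p), sub_apply]

lemma grady_sub {u v : Pt → ℝ} (hu : Differentiable ℝ u) (hv : Differentiable ℝ v) (p : Pt) :
    grady (fun p => u p - v p) p = grady u p - grady v p := by
  simp only [grady]
  rw [fderiv_fun_sub (hu p) (hv p), sub_apply]

lemma fderiv_eq_zero_of_bounded {u : Pt → ℝ} {R : ℝ} (h : ∀ p : Pt, R < ‖p.1‖ → u p = 0) {p : Pt}
    (hp : R < ‖p.1‖) : fderiv ℝ u p = 0 := by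
  have ho : IsOpen {p : Pt | R < ‖p.1‖} := isOpen_lt continuous_const (by fun_prop)
  have : u =ᶠ[𝓝 p] fun _ => 0 := by
    filter_upwards [ho.mem_nhds hp] with q hq using h q hq
  rw [this.fderiv_eq]
  simp

lemma integrableOn_dom {F : Pt → ℝ} (hF : Continuous F) {R : ℝ}
    (h : ∀ p : Pt, R < ‖p.1‖ → F p = 0) : IntegrableOn F Dom := by
  have hK : IsCompact (Metric.closedBall (0 : Pt3) R ×ˢ Set.Icc (0 : ℝ) (2 * π)) :=
    (isCompact_closedBall _ _).prod isCompact_Icc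
  have h1 : IntegrableOn F (Metric.closedBall (0 : Pt3) R ×ˢ Set.Icc (0 : ℝ) (2 * π)) :=
    hF.continuousOn.integrableOn_compact hK
  refine (h1.of_forall_sdiff_eq_zero (s := _) ?_ ?_ : IntegrableOn F Dom)
  · exact MeasurableSet.univ.prod measurableSet_Ioc
  · rintro p ⟨hp, hp'⟩
    refine h p ?_
    by_contra! hle
    exact hp' ⟨by simpa using hle, Set.Ioc_subset_Icc_self hp.2⟩

lemma integral_dom {F : Pt → ℝ} (hF : IntegrableOn F Dom) :
    ∫ p in Dom, F p = ∫ x : Pt3, ∫ y in (0 : ℝ)..(2 * π), F (x, y) := by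
  rw [IntegrableOn, volume_restrict_dom] at hF
  rw [volume_restrict_dom, integral_prod _ hF]
  refine integral_congr_ae (ae_of_all _ fun x => ?_)
  simp only
  rw [intervalIntegral.integral_of_le (by positivity)]

lemma intervalIntegral_sq_eq {f : ℝ → ℝ} (hf : Continuous f) :
    ∫ y in (0 : ℝ)..(2 * π), f y ^ 2
      = 2 * π * ((2 * π)⁻¹ * ∫ y in (0 : ℝ)..(2 * π), f y) ^ 2
        + ∫ y in (0 : ℝ)..(2 * π), (f y - (2 * π)⁻¹ * ∫ y in (0 : ℝ)..(2 * π), f y) ^ 2 := by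
  have hpi : (2 * π) ≠ 0 := by positivity
  set m := (2 * π)⁻¹ * ∫ y in (0 : ℝ)..(2 * π), f y with hm
  have hS : ∫ y in (0 : ℝ)..(2 * π), f y = 2 * π * m := by rw [hm]; field_simp
  have hI : ∀ g : ℝ → ℝ, Continuous g → IntervalIntegrable g volume 0 (2 * π) :=
    fun g hg => hg.intervalIntegrable _ _
  have : ∀ y, (f y - m) ^ 2 = f y ^ 2 - 2 * m * f y + m ^ 2 := fun y => by ring
  simp_rw [this]
  rw [intervalIntegral.integral_add (hI _ (by fun_prop)) (hI _ (by fun_prop)),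
    intervalIntegral.integral_sub (hI _ (by fun_prop)) (hI _ (by fun_prop)),
    intervalIntegral.integral_const_mul, hS]
  simp
  ring

/-- The oscillating part `u - ū` of a function on the waveguide. -/
def osc (u : Pt → ℝ) (p : Pt) : ℝ := u p - avg u p.1

lemma Nice.osc {u : Pt → ℝ} (hu : Nice u) : Nice (osc u) := hu.sub hu.lift_avg

lemma Nice.continuous_slice_y {u : Pt → ℝ} (hu : Nice u) (x : Pt3) :
    Continuous fun y => u (x, y) := hu.continuous.comp (by fun_prop)

lemma Nice.differentiable_avg {u : Pt → ℝ} (hu : Nice u) : Differentiable ℝ (avg u) :=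
  hu.contDiff_avg.differentiable one_ne_zero

lemma integral_avg (u : Pt → ℝ) (x : Pt3) :
    ∫ y in (0 : ℝ)..(2 * π), u (x, y) = 2 * π * avg u x := by
  rw [avg]
  field_simp

lemma Nice.integral_osc {u : Pt → ℝ} (hu : Nice u) (x : Pt3) :
    ∫ y in (0 : ℝ)..(2 * π), Waveguide.osc u (x, y) = 0 := by
  simp only [Waveguide.osc]
  rw [intervalIntegral.integral_sub ((hu.continuous_slice_y x).intervalIntegrable _ _) (by simp),
    integral_avg]
  simp

lemma Nice.gradx_osc {u : Pt → ℝ} (hu : Nice u) (p : Pt) (i : Fin 3) :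
    gradx (Waveguide.osc u) p i = gradx u p i - grad3 (avg u) p.1 i := by
  have := gradx_sub hu.differentiable hu.lift_avg.differentiable p i
  rw [gradx_lift (hu.differentiable_avg p.1)] at this
  exact this

lemma Nice.grady_osc {u : Pt → ℝ} (hu : Nice u) (p : Pt) :
    grady (Waveguide.osc u) p = grady u p := by
  have := grady_sub hu.differentiable hu.lift_avg.differentiable p
  rw [grady_lift (hu.differentiable_avg p.1), sub_zero] at this
  exact this

lemma gradSqX_eq_zero_of_bounded {u : Pt → ℝ} {R : ℝ} (h : ∀ p : Pt, R < ‖p.1‖ → u p = 0) {p : Pt}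
    (hp : R < ‖p.1‖) : gradSqX u p = 0 := by
  simp [gradSqX, gradx, fderiv_eq_zero_of_bounded h hp]

lemma grady_eq_zero_of_bounded {u : Pt → ℝ} {R : ℝ} (h : ∀ p : Pt, R < ‖p.1‖ → u p = 0) {p : Pt}
    (hp : R < ‖p.1‖) : grady u p = 0 := by
  simp [grady, fderiv_eq_zero_of_bounded h hp]

lemma Nice.integrable_gradSqX {u : Pt → ℝ} (hu : Nice u) : IntegrableOn (gradSqX u) Dom := by
  obtain ⟨R, hR⟩ := hu.bounded
  exact integrableOn_dom hu.continuous_gradSqX fun p hp => gradSqX_eq_zero_of_bounded hR hp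

lemma Nice.integrable_grady_sq {u : Pt → ℝ} (hu : Nice u) :
    IntegrableOn (fun p => grady u p ^ 2) Dom := by
  obtain ⟨R, hR⟩ := hu.bounded
  exact integrableOn_dom (hu.continuous_grady.pow 2)
    fun p hp => by rw [grady_eq_zero_of_bounded hR hp]; simp

lemma Nice.integrable_pow {u : Pt → ℝ} (hu : Nice u) {n : ℕ} (hn : n ≠ 0) :
    IntegrableOn (fun p => u p ^ n) Dom := by
  obtain ⟨R, hR⟩ := hu.bounded
  exact integrableOn_dom (hu.continuous.pow n) fun p hp => by rw [hR p hp, zero_pow hn]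

lemma Nice.integrable_mul {u F : Pt → ℝ} (hu : Nice u) (hF : Continuous F) :
    IntegrableOn (fun p => u p * F p) Dom := by
  obtain ⟨R, hR⟩ := hu.bounded
  exact integrableOn_dom (hu.continuous.mul hF) fun p hp => by rw [hR p hp, zero_mul]

lemma integral_lift {f : Pt3 → ℝ} :
    ∫ p : Pt in Dom, f p.1 = 2 * π * ∫ x, f x := by
  rw [volume_restrict_dom]
  have := integral_prod_mul (μ := (volume : Measure Pt3))
    (ν := volume.restrict (Set.Ioc (0 : ℝ) (2 * π))) f (fun _ => 1)
  simp only [mul_one] at this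
  rw [this]
  simp [Real.pi_pos.le, mul_comm]

lemma integrableOn_lift {f : Pt3 → ℝ} (hf : Integrable f) :
    IntegrableOn (fun p : Pt => f p.1) Dom := by
  rw [IntegrableOn, volume_restrict_dom]
  exact hf.comp_fst _

lemma Nice.integral_gradSqX {u : Pt → ℝ} (hu : Nice u) :
    ∫ p in Dom, gradSqX u p
      = (2 * π * ∫ x, gradSq3 (avg u) x) + ∫ p in Dom, gradSqX (Waveguide.osc u) p := by
  rw [← integral_lift (f := gradSq3 (avg u))]
  have hl : IntegrableOn (fun p : Pt => gradSq3 (avg u) p.1) Dom := by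
    refine hu.lift_avg.integrable_gradSqX.congr_fun ?_ (MeasurableSet.univ.prod measurableSet_Ioc)
    exact fun p _ => gradSqX_lift (hu.differentiable_avg p.1)
  have hadd : IntegrableOn (fun p => gradSq3 (avg u) p.1 + gradSqX (Waveguide.osc u) p) Dom :=
    hl.add hu.osc.integrable_gradSqX
  rw [← integral_add hl hu.osc.integrable_gradSqX, integral_dom hu.integrable_gradSqX,
    integral_dom hadd]
  refine integral_congr_ae (ae_of_all _ fun x => ?_)
  have hc : ∀ i, Continuous fun y => gradx u (x, y) i := fun i =>
    (hu.continuous_gradx i).comp (by fun_prop)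
  have h1 : ∀ i, ∫ y in (0 : ℝ)..(2 * π), gradx u (x, y) i ^ 2
      = ∫ y in (0 : ℝ)..(2 * π), (grad3 (avg u) x i ^ 2 + gradx (Waveguide.osc u) (x, y) i ^ 2) := by
    intro i
    have hg : ∀ y, gradx (Waveguide.osc u) (x, y) i = gradx u (x, y) i - grad3 (avg u) x i :=
      fun y => hu.gradx_osc (x, y) i
    simp_rw [hg]
    have hc' : Continuous fun y => (gradx u (x, y) i - grad3 (avg u) x i) ^ 2 :=
      ((hc i).sub continuous_const).pow 2
    rw [intervalIntegral.integral_add (by simp) (hc'.intervalIntegrable _ _), hu.grad3_avg,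
      intervalIntegral_sq_eq (hc i)]
    simp
  simp only [gradSqX, gradSq3, ← Finset.sum_add_distrib]
  have hc1 : ∀ i, Continuous fun y => gradx u (x, y) i ^ 2 := fun i => (hc i).pow 2
  have hc2 : ∀ i, Continuous fun y =>
      grad3 (avg u) x i ^ 2 + gradx (Waveguide.osc u) (x, y) i ^ 2 := fun i =>
    continuous_const.add
      (((hu.osc.continuous_gradx i).comp (by fun_prop : Continuous fun y : ℝ => (x, y))).pow 2)
  rw [intervalIntegral.integral_finsetSum fun i _ => (hc1 i).intervalIntegrable _ _,
    intervalIntegral.integral_finsetSum fun i _ => (hc2 i).intervalIntegrable _ _]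
  exact Finset.sum_congr rfl fun i _ => h1 i

lemma Nice.integral_avg_sq_le {u : Pt → ℝ} (hu : Nice u) :
    2 * π * ∫ x, avg u x ^ 2 ≤ ∫ p in Dom, u p ^ 2 := by
  rw [← integral_lift (f := fun x => avg u x ^ 2)]
  have hl : IntegrableOn (fun p : Pt => avg u p.1 ^ 2) Dom := hu.lift_avg.integrable_pow two_ne_zero
  have ho : IntegrableOn (fun p : Pt => Waveguide.osc u p ^ 2) Dom :=
    hu.osc.integrable_pow two_ne_zero
  have h : ∫ p in Dom, u p ^ 2 = ∫ p in Dom, (avg u p.1 ^ 2 + Waveguide.osc u p ^ 2) := by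
    have hadd : IntegrableOn (fun p => avg u p.1 ^ 2 + Waveguide.osc u p ^ 2) Dom := hl.add ho
    rw [integral_dom (hu.integrable_pow two_ne_zero), integral_dom hadd]
    refine integral_congr_ae (ae_of_all _ fun x => ?_)
    simp only [Waveguide.osc]
    have hc : Continuous fun y => (u (x, y) - avg u x) ^ 2 :=
      ((hu.continuous_slice_y x).sub continuous_const).pow 2
    rw [intervalIntegral_sq_eq (hu.continuous_slice_y x),
      intervalIntegral.integral_add (by simp) (hc.intervalIntegrable _ _)]
    simp [avg]
  rw [h, integral_add hl ho]
  have : 0 ≤ ∫ p in Dom, Waveguide.osc u p ^ 2 := integral_nonneg fun _ => sq_nonneg _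
  linarith

lemma exists_interaction_real : ∃ C : ℝ, 0 ≤ C ∧ ∀ g w : Pt → ℝ, Nice g → Nice w →
    (∀ x, ∫ y in (0 : ℝ)..(2 * π), w (x, y) = 0) →
    ∫ p in Dom, g p ^ 2 * w p ^ 2 ≤ C * ((∫ p in Dom, gradSqX g p)
      * (√(∫ p in Dom, gradSqX w p) * √(∫ p in Dom, grady w p ^ 2))) := by
  obtain ⟨C, hC⟩ := exists_interaction
  refine ⟨C, C.2, fun g w hg hw h0 => ?_⟩
  have h := hC g w hg hw h0
  have e1 : ∀ u : Pt → ℝ, Nice u → dirX u = ENNReal.ofReal (∫ p in Dom, gradSqX u p) := by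
    intro u hu
    rw [dirX, ofReal_integral_eq_lintegral_ofReal hu.integrable_gradSqX
      (ae_of_all _ fun p => gradSqX_nonneg u p)]
  have e2 : dirY w = ENNReal.ofReal (∫ p in Dom, grady w p ^ 2) := by
    rw [dirY, ofReal_integral_eq_lintegral_ofReal hw.integrable_grady_sq
      (ae_of_all _ fun p => sq_nonneg _)]
  have hint : IntegrableOn (fun p => g p ^ 2 * w p ^ 2) Dom := by
    refine (hg.integrable_mul (hg.continuous.mul (hw.continuous.pow 2))).congr_fun
      (fun p _ => ?_) (MeasurableSet.univ.prod measurableSet_Ioc)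
    simp only [Pi.mul_apply, Pi.pow_apply]; ring
  have e3 : ∫⁻ p in Dom, ‖g p‖ₑ ^ 2 * ‖w p‖ₑ ^ 2
      = ENNReal.ofReal (∫ p in Dom, g p ^ 2 * w p ^ 2) := by
    rw [ofReal_integral_eq_lintegral_ofReal hint
      (ae_of_all _ fun p => by positivity)]
    refine lintegral_congr fun p => ?_
    rw [← enorm_pow, ← enorm_pow, ← enorm_mul, Real.enorm_of_nonneg (by positivity)]
  have nx : ∀ u : Pt → ℝ, 0 ≤ ∫ p in Dom, gradSqX u p :=
    fun u => integral_nonneg fun p => gradSqX_nonneg u p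
  have ny : 0 ≤ ∫ p in Dom, grady w p ^ 2 := integral_nonneg fun p => sq_nonneg _
  rw [e3, e1 g hg, e1 w hw, e2, ENNReal.ofReal_rpow_of_nonneg (nx w) (by norm_num),
    ENNReal.ofReal_rpow_of_nonneg ny (by norm_num), ← ENNReal.ofReal_mul (Real.rpow_nonneg (nx w) _),
    ← ENNReal.ofReal_mul (nx g), ← ENNReal.ofReal_coe_nnreal, ← ENNReal.ofReal_mul (by simp),
    ENNReal.ofReal_le_ofReal_iff (by have := nx g; have := nx w; positivity),
    ← Real.sqrt_eq_rpow, ← Real.sqrt_eq_rpow] at h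
  exact h

lemma quartic_split (a b w z : ℝ) :
    (a + w) ^ 4 + 2 * (a + w) ^ 2 * (b + z) ^ 2 + (b + z) ^ 4
      ≤ (a ^ 4 + 2 * a ^ 2 * b ^ 2 + b ^ 4) + 4 * (w * ((a ^ 2 + b ^ 2) * a)
          + z * ((a ^ 2 + b ^ 2) * b))
        + (8 * (a ^ 2 * w ^ 2 + a ^ 2 * z ^ 2 + b ^ 2 * w ^ 2 + b ^ 2 * z ^ 2)
          + 6 * (w ^ 2 * w ^ 2 + z ^ 2 * z ^ 2)) := by
  nlinarith [sq_nonneg (a * z - b * w), sq_nonneg (w ^ 2 - z ^ 2),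
    sq_nonneg (a * w + b * z - (w ^ 2 + z ^ 2))]

lemma Nice.integral_osc_mul {u : Pt → ℝ} (hu : Nice u) {f : Pt3 → ℝ} (hf : Continuous f) :
    ∫ p in Dom, Waveguide.osc u p * f p.1 = 0 := by
  have h : IntegrableOn (fun p : Pt => Waveguide.osc u p * f p.1) Dom :=
    hu.osc.integrable_mul (hf.comp continuous_fst)
  rw [integral_dom h]
  simp [intervalIntegral.integral_mul_const, hu.integral_osc]

/-- The nonlinear energy of `(u, v)` is that of the `y`-averages up to an interaction term. -/
lemma exists_integral_nonlin_le : ∃ C : ℝ, 0 ≤ C ∧ ∀ u v : Pt → ℝ, Nice u → Nice v →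
    ∫ p in Dom, nonlin u v p ≤ (2 * π * ∫ x, nonlin3 (avg u) (avg v) x)
      + C * (((∫ p in Dom, gradSqX u p) + ∫ p in Dom, gradSqX v p)
        * (√((∫ p in Dom, gradSqX (osc u) p) + ∫ p in Dom, gradSqX (osc v) p)
          * √((∫ p in Dom, grady u p ^ 2) + ∫ p in Dom, grady v p ^ 2))) := by
  obtain ⟨C, hC0, hC⟩ := exists_interaction_real
  refine ⟨44 * C, by positivity, fun u v hu hv => ?_⟩
  have nx : ∀ u : Pt → ℝ, 0 ≤ ∫ p in Dom, gradSqX u p :=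
    fun u => integral_nonneg fun p => gradSqX_nonneg u p
  have ny : ∀ u : Pt → ℝ, 0 ≤ ∫ p in Dom, grady u p ^ 2 :=
    fun u => integral_nonneg fun p => sq_nonneg _
  have havg : ∀ u : Pt → ℝ, Nice u →
      ∫ p in Dom, gradSqX (lift (avg u)) p ≤ ∫ p in Dom, gradSqX u p := by
    intro u hu
    have h1 : ∫ p in Dom, gradSqX (lift (avg u)) p = 2 * π * ∫ x, gradSq3 (avg u) x := by
      rw [← integral_lift (f := gradSq3 (avg u))]
      exact integral_congr_ae (ae_of_all _ fun p => gradSqX_lift (hu.differentiable_avg p.1))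
    rw [hu.integral_gradSqX, h1]
    linarith [nx (osc u)]
  have hosc : ∀ u : Pt → ℝ, Nice u →
      ∫ p in Dom, gradSqX (osc u) p ≤ ∫ p in Dom, gradSqX u p := by
    intro u hu
    rw [hu.integral_gradSqX]
    have : 0 ≤ ∫ x, gradSq3 (avg u) x := integral_nonneg fun x => gradSq3_nonneg _ x
    have := mul_nonneg Real.two_pi_pos.le this
    linarith
  set A := (∫ p in Dom, gradSqX u p) + ∫ p in Dom, gradSqX v p with hA
  set α := (∫ p in Dom, gradSqX (osc u) p) + ∫ p in Dom, gradSqX (osc v) p with hα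
  set B := (∫ p in Dom, grady u p ^ 2) + ∫ p in Dom, grady v p ^ 2 with hB
  have key : ∀ g w : Pt → ℝ, Nice g → Nice w → (∫ p in Dom, gradSqX g p ≤ A) →
      (∫ p in Dom, gradSqX (osc w) p ≤ α) → (∫ p in Dom, grady w p ^ 2 ≤ B) →
      ∫ p in Dom, g p ^ 2 * osc w p ^ 2 ≤ C * (A * (√α * √B)) := by
    intro g w hg hw h1 h2 h3
    refine (hC g (osc w) hg hw.osc hw.integral_osc).trans ?_
    simp only [hw.grady_osc]
    have := nx g
    gcongr
    exact this.trans h1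
  have gu : ∫ p in Dom, gradSqX (lift (avg u)) p ≤ A := by linarith [havg u hu, nx v]
  have gv : ∫ p in Dom, gradSqX (lift (avg v)) p ≤ A := by linarith [havg v hv, nx u]
  have ou : ∫ p in Dom, gradSqX (osc u) p ≤ A := by linarith [hosc u hu, nx v]
  have ov : ∫ p in Dom, gradSqX (osc v) p ≤ A := by linarith [hosc v hv, nx u]
  have αu : ∫ p in Dom, gradSqX (osc u) p ≤ α := by linarith [nx (osc v)]
  have αv : ∫ p in Dom, gradSqX (osc v) p ≤ α := by linarith [nx (osc u)]
  have Bu : ∫ p in Dom, grady u p ^ 2 ≤ B := by linarith [ny v]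
  have Bv : ∫ p in Dom, grady v p ^ 2 ≤ B := by linarith [ny u]
  have k1 := key _ u hu.lift_avg hu gu αu Bu
  have k2 := key _ v hu.lift_avg hv gu αv Bv
  have k3 := key _ u hv.lift_avg hu gv αu Bu
  have k4 := key _ v hv.lift_avg hv gv αv Bv
  have k5 := key _ u hu.osc hu ou αu Bu
  have k6 := key _ v hv.osc hv ov αv Bv
  have isq : ∀ g w : Pt → ℝ, Nice g → Nice w →
      IntegrableOn (fun p => g p ^ 2 * w p ^ 2) Dom := by
    intro g w hg hw
    refine (hg.integrable_mul (hg.continuous.mul (hw.continuous.pow 2))).congr_fun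
      (fun p _ => ?_) (MeasurableSet.univ.prod measurableSet_Ioc)
    simp only [Pi.mul_apply, Pi.pow_apply]; ring
  have i1 := isq _ _ hu.lift_avg hu.osc
  have i2 := isq _ _ hu.lift_avg hv.osc
  have i3 := isq _ _ hv.lift_avg hu.osc
  have i4 := isq _ _ hv.lift_avg hv.osc
  have i5 := isq _ _ hu.osc hu.osc
  have i6 := isq _ _ hv.osc hv.osc
  have cu := hu.contDiff_avg.continuous
  have cv := hv.contDiff_avg.continuous
  have hcf : Continuous fun x => (avg u x ^ 2 + avg v x ^ 2) * avg u x := by fun_prop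
  have hcg : Continuous fun x => (avg u x ^ 2 + avg v x ^ 2) * avg v x := by fun_prop
  have j1 := hu.osc.integrable_mul (hcf.comp continuous_fst)
  have j2 := hv.osc.integrable_mul (hcg.comp continuous_fst)
  have z1 := hu.integral_osc_mul hcf
  have z2 := hv.integral_osc_mul hcg
  have inl : ∀ u v : Pt → ℝ, Nice u → Nice v → IntegrableOn (nonlin u v) Dom := by
    intro u v hu hv
    have h : IntegrableOn (fun p => 2 * u p ^ 2 * v p ^ 2) Dom := by
      have := (isq u v hu hv).const_mul 2
      simp only [← mul_assoc] at this
      exact this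
    exact ((hu.integrable_pow four_ne_zero).add h).add (hv.integrable_pow four_ne_zero)
  have l0 : ∫ p in Dom, nonlin (lift (avg u)) (lift (avg v)) p
      = 2 * π * ∫ x, nonlin3 (avg u) (avg v) x :=
    integral_lift (f := nonlin3 (avg u) (avg v))
  have i0 := inl _ _ hu.lift_avg hv.lift_avg
  have iR := ((((i1.add i2).add i3).add i4).const_mul 8).add ((i5.add i6).const_mul 6)
  have iM := (j1.add j2).const_mul 4
  have hle : ∫ p in Dom, nonlin u v p ≤ _ :=
    integral_mono (inl u v hu hv) ((i0.add iM).add iR) fun p => by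
      have := quartic_split (avg u p.1) (avg v p.1) (osc u p) (osc v p)
      have e1 : avg u p.1 + osc u p = u p := by simp [osc]
      have e2 : avg v p.1 + osc v p = v p := by simp [osc]
      rw [e1, e2] at this
      exact this
  refine hle.trans ?_
  rw [integral_add' (i0.add iM) iR, integral_add' i0 iM, l0]
  have eM := integral_const_mul (μ := volume.restrict Dom) 4
    ((fun p => osc u p * ((fun x => (avg u x ^ 2 + avg v x ^ 2) * avg u x) ∘ Prod.fst) p)
      + fun p => osc v p * ((fun x => (avg u x ^ 2 + avg v x ^ 2) * avg v x) ∘ Prod.fst) p : Pt → ℝ)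
  rw [integral_add' j1 j2] at eM
  simp only [Function.comp_apply, Pi.add_apply] at eM
  rw [z1, z2] at eM
  have eR := integral_add' ((((i1.add i2).add i3).add i4).const_mul 8)
    ((i5.add i6).const_mul 6)
  rw [integral_const_mul, integral_const_mul, integral_add' ((i1.add i2).add i3) i4,
    integral_add' (i1.add i2) i3, integral_add' i1 i2, integral_add' i5 i6] at eR
  simp only [Function.comp_apply, Pi.add_apply] at eR ⊢
  rw [eM, eR]
  linarith

/-- The mass-constrained Gagliardo-Nirenberg inequality on `ℝ³`, with constant `κ`, normalised on
`y`-independent functions of the waveguide. -/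
def GagliardoNirenberg (κ : ℝ) : Prop :=
  ∀ f g : Pt3 → ℝ, ContDiff ℝ 1 f → ContDiff ℝ 1 g → (∃ R : ℝ, ∀ x, R < ‖x‖ → f x = 0) →
    (∃ R : ℝ, ∀ x, R < ‖x‖ → g x = 0) →
    2 * π * (∫ x, f x ^ 2) + 2 * π * (∫ x, g x ^ 2) ≤ 2 →
    2 * π * ∫ x, nonlin3 f g x
      ≤ κ * ((2 * π * (∫ x, gradSq3 f x) + 2 * π * ∫ x, gradSq3 g x)
        * √(2 * π * (∫ x, gradSq3 f x) + 2 * π * ∫ x, gradSq3 g x))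

lemma exists_nice_inequality : ∃ C : ℝ, 0 ≤ C ∧ ∀ κ : ℝ, 0 < κ → GagliardoNirenberg κ →
    ∀ u v : Pt → ℝ, Nice u → Nice v →
    (∫ p in Dom, u p ^ 2) + (∫ p in Dom, v p ^ 2) ≤ 2 →
    ∫ p in Dom, nonlin u v p ≤ κ * (((∫ p in Dom, gradSqX u p) + ∫ p in Dom, gradSqX v p)
      * √((∫ p in Dom, gradSqX u p) + ∫ p in Dom, gradSqX v p))
      * (1 + C / κ ^ 2 * ((∫ p in Dom, grady u p ^ 2) + ∫ p in Dom, grady v p ^ 2)) := by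
  obtain ⟨C, hC0, hC⟩ := exists_integral_nonlin_le
  refine ⟨C ^ 2 / 4, by positivity, fun κ hκ hGN u v hu hv hm => ?_⟩
  have nx : ∀ u : Pt → ℝ, 0 ≤ ∫ p in Dom, gradSqX u p :=
    fun u => integral_nonneg fun p => gradSqX_nonneg u p
  have ny : ∀ u : Pt → ℝ, 0 ≤ ∫ p in Dom, grady u p ^ 2 :=
    fun u => integral_nonneg fun p => sq_nonneg _
  have na : ∀ f : Pt3 → ℝ, 0 ≤ 2 * π * ∫ x, gradSq3 f x :=
    fun f => mul_nonneg Real.two_pi_pos.le (integral_nonneg fun x => gradSq3_nonneg _ x)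
  have h1 := hC u v hu hv
  have h2 := hGN (avg u) (avg v) hu.contDiff_avg hv.contDiff_avg hu.avg_bounded hv.avg_bounded
    (by linarith [hu.integral_avg_sq_le, hv.integral_avg_sq_le])
  have ha : 0 ≤ 2 * π * (∫ x, gradSq3 (avg u) x) + 2 * π * ∫ x, gradSq3 (avg v) x :=
    add_nonneg (na _) (na _)
  have hA : (∫ p in Dom, gradSqX u p) + ∫ p in Dom, gradSqX v p
      = (2 * π * (∫ x, gradSq3 (avg u) x) + 2 * π * ∫ x, gradSq3 (avg v) x)
        + ((∫ p in Dom, gradSqX (osc u) p) + ∫ p in Dom, gradSqX (osc v) p) := by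
    rw [hu.integral_gradSqX, hv.integral_gradSqX]; ring
  have hA0 := add_nonneg (nx u) (nx v)
  have hα := add_nonneg (nx (osc u)) (nx (osc v))
  have hB := add_nonneg (ny u) (ny v)
  set a := 2 * π * (∫ x, gradSq3 (avg u) x) + 2 * π * ∫ x, gradSq3 (avg v) x
  set A := (∫ p in Dom, gradSqX u p) + ∫ p in Dom, gradSqX v p
  set α := (∫ p in Dom, gradSqX (osc u) p) + ∫ p in Dom, gradSqX (osc v) p
  set B := (∫ p in Dom, grady u p ^ 2) + ∫ p in Dom, grady v p ^ 2
  have h3 : a * √a ≤ (A - α) * √A := by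
    rw [hA, add_sub_cancel_right]
    gcongr
    linarith
  have hs := Real.sq_sqrt hA0
  have ht := Real.sq_sqrt hα
  have hb := Real.sq_sqrt hB
  have hs0 := Real.sqrt_nonneg A
  have h4 : C * (A * (√α * √B)) ≤ κ * (α * √A) + C ^ 2 / (4 * κ) * (A * √A * B) := by
    have : 0 ≤ √A * (κ * √α - C * √A * √B / 2) ^ 2 / κ := by positivity
    have e : √A * (κ * √α - C * √A * √B / 2) ^ 2 / κ = κ * (√α ^ 2 * √A)
        + C ^ 2 / (4 * κ) * (√A ^ 2 * √A * √B ^ 2) - C * (√A ^ 2 * (√α * √B)) := by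
      field_simp; ring
    rw [e, hs, ht, hb] at this
    linarith
  have h5 := mul_le_mul_of_nonneg_left h3 hκ.le
  have e : κ * (A * √A) * (1 + C ^ 2 / 4 / κ ^ 2 * B)
      = κ * (A * √A) + C ^ 2 / (4 * κ) * (A * √A * B) := by
    field_simp
  rw [e]
  linarith

instance isAddHaarMeasure_volume_pt : (volume : Measure Pt).IsAddHaarMeasure :=
  Measure.prod.instIsAddHaarMeasure (volume : Measure Pt3) (volume : Measure ℝ)

lemma PeriodicY.zsmul {F : Pt → ℝ} (hF : PeriodicY F) (n : ℤ) (x : Pt3) (y : ℝ) :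
    F (x, n • (2 * π) + y) = F (x, y) := by
  have : Function.Periodic (fun y => F (x, y)) (2 * π) := fun y => hF x y
  rw [add_comm]
  exact this.zsmul n y

lemma lintegral_window {F : ℝ → ℝ≥0∞} (hF : Function.Periodic F (2 * π)) (a : ℝ) :
    ∫⁻ y in Set.Ioc a (a + 2 * π), F y = ∫⁻ y in Set.Ioc (0 : ℝ) (2 * π), F y := by
  have h0 := isAddFundamentalDomain_Ioc Real.two_pi_pos 0
  rw [zero_add] at h0
  refine (isAddFundamentalDomain_Ioc Real.two_pi_pos a).setLIntegral_eq h0 F fun g y => ?_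
  obtain ⟨n, hn⟩ := AddSubgroup.mem_zmultiples_iff.1 g.2
  have : g +ᵥ y = y + n • (2 * π) := by
    rw [hn, AddSubgroup.vadd_def, vadd_eq_add, add_comm]
  rw [this]
  exact hF.zsmul n y

/-- The `L²` norm over a period is invariant under translations. -/
lemma lintegral_dom_shift {F : Pt → ℝ≥0∞} (hF : Measurable F)
    (hper : ∀ x y, F (x, y + 2 * π) = F (x, y)) (t : Pt) :
    ∫⁻ p in Dom, F (p - t) = ∫⁻ p in Dom, F p := by
  have hFt : Measurable fun p => F (p - t) := hF.comp (measurable_id.sub_const t)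
  rw [lintegral_dom hFt, lintegral_dom hF]
  have h1 : ∀ x : Pt3, ∫⁻ y in Set.Ioc (0 : ℝ) (2 * π), F ((x, y) - t)
      = ∫⁻ y in Set.Ioc (0 : ℝ) (2 * π), F (x - t.1, y) := by
    intro x
    rw [← lintegral_window (F := fun y => F (x - t.1, y)) (fun y => hper _ y) (0 - t.2)]
    have hpre : (fun y => y - t.2) ⁻¹' Set.Ioc (0 - t.2) (0 - t.2 + 2 * π)
        = Set.Ioc (0 : ℝ) (2 * π) := by
      ext y; simp only [Set.mem_preimage, Set.mem_Ioc]
      constructor <;> rintro ⟨h, h'⟩ <;> constructor <;> linarith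
    rw [← hpre]
    exact ((measurePreserving_sub_right volume t.2).setLIntegral_comp_preimage measurableSet_Ioc
      (hF.comp (measurable_prodMk_left (x := x - t.1))))
  simp_rw [h1]
  exact lintegral_sub_right_eq_self (fun x => ∫⁻ y in Set.Ioc (0 : ℝ) (2 * π), F (x, y)) t.1

lemma lintegral_dom_average_le {h : Pt → ℝ} (hm : Measurable h) (hper : PeriodicY h)
    (ν : Measure Pt) [IsProbabilityMeasure ν] :
    ∫⁻ p in Dom, ‖∫ t, h (p - t) ∂ν‖ₑ ^ 2 ≤ ∫⁻ p in Dom, ‖h p‖ₑ ^ 2 := by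
  have h1 : ∀ p, ‖∫ t, h (p - t) ∂ν‖ₑ ^ 2 ≤ ∫⁻ t, ‖h (p - t)‖ₑ ^ 2 ∂ν := by
    intro p
    have hmp : Measurable fun t => ‖h (p - t)‖ₑ := (hm.comp (measurable_const.sub measurable_id)).enorm
    have h2 := lintegral_cauchy_schwarz ν hmp.aemeasurable (aemeasurable_const (b := (1 : ℝ≥0∞)))
    simp only [mul_one, one_pow, lintegral_const, measure_univ, ENNReal.one_rpow] at h2
    calc ‖∫ t, h (p - t) ∂ν‖ₑ ^ 2
        ≤ ((∫⁻ t, ‖h (p - t)‖ₑ ^ 2 ∂ν) ^ (1 / 2 : ℝ)) ^ 2 := by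
          gcongr
          exact (enorm_integral_le_lintegral_enorm _).trans h2
      _ = _ := by
          rw [← ENNReal.rpow_natCast, ← ENNReal.rpow_mul]; norm_num
  have hmeas : Measurable fun q : Pt × Pt => ‖h (q.1 - q.2)‖ₑ ^ 2 :=
    ((hm.comp (measurable_fst.sub measurable_snd)).enorm).pow_const 2
  calc ∫⁻ p in Dom, ‖∫ t, h (p - t) ∂ν‖ₑ ^ 2
      ≤ ∫⁻ p in Dom, ∫⁻ t, ‖h (p - t)‖ₑ ^ 2 ∂ν := lintegral_mono h1
    _ = ∫⁻ t, (∫⁻ p in Dom, ‖h (p - t)‖ₑ ^ 2) ∂ν := lintegral_lintegral_swap hmeas.aemeasurable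
    _ = ∫⁻ t, (∫⁻ p in Dom, ‖h p‖ₑ ^ 2) ∂ν := by
        refine lintegral_congr fun t => ?_
        exact lintegral_dom_shift (F := fun p => ‖h p‖ₑ ^ 2) (hm.enorm.pow_const 2)
          (fun x y => by rw [hper x y]) t
    _ = _ := by simp

lemma measurableSet_dom : MeasurableSet Dom := MeasurableSet.univ.prod measurableSet_Ioc

lemma locallyIntegrable_of_dom {h : Pt → ℝ} (hm : Measurable h) (hper : PeriodicY h)
    (hint : IntegrableOn (fun p => h p ^ 2) Dom) : LocallyIntegrable h volume := by
  intro p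
  set s : Set Pt := Metric.ball p 1 with hs
  refine ⟨s, Metric.ball_mem_nhds p one_pos, ?_⟩
  have hfin : volume s ≠ ∞ := measure_ball_lt_top.ne
  set t : Pt := (0, -(p.2 - π)) with ht
  have hsub : s ⊆ (fun q => q + t) ⁻¹' Dom := by
    intro q hq
    have h2 : |q.2 - p.2| < 1 := by
      have := (norm_snd_le (q - p)).trans_lt (mem_ball_iff_norm.1 hq)
      simpa using this
    have := Real.pi_gt_three
    rw [abs_lt] at h2
    simp only [Dom, Set.mem_preimage, Set.mem_prod, Set.mem_univ, Set.mem_Ioc, true_and, ht,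
      Prod.snd_add]
    constructor <;> linarith
  have hsq : IntegrableOn (fun q => h q ^ 2) s := by
    refine ⟨(hm.pow_const 2).aestronglyMeasurable, ?_⟩
    rw [HasFiniteIntegral]
    calc ∫⁻ q in s, ‖h q ^ 2‖ₑ ≤ ∫⁻ q in (fun q => q + t) ⁻¹' Dom, ‖h q ^ 2‖ₑ :=
          lintegral_mono_set hsub
      _ = ∫⁻ q in (fun q => q + t) ⁻¹' Dom, (fun q => ‖h (q - t) ^ 2‖ₑ) (q + t) := by simp
      _ = ∫⁻ q in Dom, ‖h (q - t) ^ 2‖ₑ :=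
          (measurePreserving_add_right volume t).setLIntegral_comp_preimage measurableSet_dom
            ((hm.comp (measurable_id.sub_const t)).pow_const 2).enorm
      _ = ∫⁻ q in Dom, ‖h q ^ 2‖ₑ :=
          lintegral_dom_shift (F := fun p => ‖h p ^ 2‖ₑ) (hm.pow_const 2).enorm
            (fun x y => by rw [hper x y]) t
      _ < ∞ := hint.2
  refine ((integrableOn_const hfin (C := (1 : ℝ))).add hsq).mono' hm.aestronglyMeasurable
    (ae_of_all _ fun q => ?_)
  rw [Real.norm_eq_abs, Pi.add_apply, ← sq_abs]
  nlinarith [sq_nonneg (|h q| - 1)]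

/-- Convolution with a normalised bump function. -/
def mollify (φ : ContDiffBump (0 : Pt)) (u : Pt → ℝ) (p : Pt) : ℝ :=
  ∫ t, φ.normed volume t * u (p - t)

lemma mollify_eq_convolution (φ : ContDiffBump (0 : Pt)) (u : Pt → ℝ) :
    mollify φ u = convolution (φ.normed volume) u (ContinuousLinearMap.lsmul ℝ ℝ) volume := rfl

/-- The probability measure with density a normalised bump function. -/
def bumpMeasure (φ : ContDiffBump (0 : Pt)) : Measure Pt :=
  volume.withDensity fun t => ENNReal.ofReal (φ.normed volume t)

instance isProbabilityMeasure_bumpMeasure (φ : ContDiffBump (0 : Pt)) :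
    IsProbabilityMeasure (bumpMeasure φ) := by
  refine ⟨?_⟩
  rw [bumpMeasure, withDensity_apply _ MeasurableSet.univ, setLIntegral_univ,
    ← ofReal_integral_eq_lintegral_ofReal φ.integrable_normed (ae_of_all _ φ.nonneg_normed),
    φ.integral_normed, ENNReal.ofReal_one]

lemma mollify_eq_integral (φ : ContDiffBump (0 : Pt)) (u : Pt → ℝ) (p : Pt) :
    mollify φ u p = ∫ t, u (p - t) ∂bumpMeasure φ := by
  rw [bumpMeasure, integral_withDensity_eq_integral_toReal_smul
    φ.continuous_normed.measurable.ennreal_ofReal (ae_of_all _ fun _ => ENNReal.ofReal_lt_top)]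
  simp only [ENNReal.toReal_ofReal (φ.nonneg_normed _), smul_eq_mul]
  rfl

lemma mollify_periodic (φ : ContDiffBump (0 : Pt)) {u : Pt → ℝ} (hu : PeriodicY u) :
    PeriodicY (mollify φ u) := by
  intro x y
  refine integral_congr_ae (ae_of_all _ fun t => ?_)
  have h1 : ((x, y + 2 * π) : Pt) - t = (x - t.1, y - t.2 + 2 * π) := by
    ext <;> simp; ring
  have h2 : ((x, y) : Pt) - t = (x - t.1, y - t.2) := rfl
  simp only
  rw [h1, h2, hu]

lemma contDiff_mollify (φ : ContDiffBump (0 : Pt)) {u : Pt → ℝ} (hu : LocallyIntegrable u volume) :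
    ContDiff ℝ 1 (mollify φ u) := by
  rw [mollify_eq_convolution]
  exact φ.hasCompactSupport_normed.contDiff_convolution_left (n := 1) _ φ.contDiff_normed hu

lemma fderiv_mollify (φ : ContDiffBump (0 : Pt)) {u : Pt → ℝ} (hd : Differentiable ℝ u) (e : Pt)
    (he : LocallyIntegrable (fun p => fderiv ℝ u p e) volume) (p : Pt) :
    fderiv ℝ (mollify φ u) p e = mollify φ (fun p => fderiv ℝ u p e) p := by
  have hu : LocallyIntegrable u volume := hd.continuous.locallyIntegrable
  have hφ1 : ContDiff ℝ 1 (φ.normed (volume : Measure Pt)) := φ.contDiff_normed (n := 1)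
  have hφc := φ.hasCompactSupport_normed (μ := (volume : Measure Pt))
  have hφ' : HasCompactSupport (fderiv ℝ (φ.normed (volume : Measure Pt))) := hφc.fderiv ℝ
  have h1 := hφc.hasFDerivAt_convolution_left (ContinuousLinearMap.lsmul ℝ ℝ) hφ1 hu p
  have h2 : ConvolutionExistsAt (fderiv ℝ (φ.normed (volume : Measure Pt))) u p
      ((ContinuousLinearMap.lsmul ℝ ℝ).precompL Pt) volume :=
    hφ'.convolutionExists_left _ (hφ1.continuous_fderiv one_ne_zero) hu p
  have h3 : ∀ t, fderiv ℝ (fun t => u (p - t)) t e = - fderiv ℝ u (p - t) e := by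
    intro t
    have := ((hd (p - t)).hasFDerivAt.comp t ((hasFDerivAt_id t).const_sub p)).fderiv
    simp only [Function.comp_def] at this
    rw [this]; simp
  have i1 : Integrable (fun t => fderiv ℝ (φ.normed (volume : Measure Pt)) t e * u (p - t)) volume := by
    have := h2.integrable.apply_continuousLinearMap e
    exact this
  have i2 : Integrable (fun t => φ.normed volume t * fderiv ℝ u (p - t) e) volume :=
    hφc.convolutionExists_left (ContinuousLinearMap.lsmul ℝ ℝ) hφ1.continuous he p
  have i3 : Integrable (fun t => φ.normed volume t * u (p - t)) volume :=
    hφc.convolutionExists_left (ContinuousLinearMap.lsmul ℝ ℝ) hφ1.continuous hu p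
  have i2' : Integrable (fun t => φ.normed volume t * fderiv ℝ (fun t => u (p - t)) t e) volume := by
    simp only [h3, mul_neg]; exact i2.neg
  have d1 : Differentiable ℝ (φ.normed (volume : Measure Pt)) := hφ1.differentiable one_ne_zero
  have d2 : Differentiable ℝ fun t => u (p - t) := hd.comp (differentiable_id.const_sub p)
  have ibp := integral_mul_fderiv_eq_neg_fderiv_mul_of_integrable (μ := (volume : Measure Pt))
    (f := φ.normed (volume : Measure Pt)) (g := fun t => u (p - t)) (v := e) i1
    i2' i3 (fun t _ => d1 t) (fun t _ => d2 t)
  simp only [h3, mul_neg, integral_neg, neg_inj] at ibp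
  rw [mollify_eq_convolution, h1.fderiv, convolution_def, ContinuousLinearMap.integral_apply h2.integrable,
    mollify, ibp]
  refine integral_congr_ae (ae_of_all _ fun t => ?_)
  simp

lemma lintegral_mollify_le (φ : ContDiffBump (0 : Pt)) {h : Pt → ℝ} (hm : Measurable h)
    (hper : PeriodicY h) :
    ∫⁻ p in Dom, ‖mollify φ h p‖ₑ ^ 2 ≤ ∫⁻ p in Dom, ‖h p‖ₑ ^ 2 := by
  simp_rw [mollify_eq_integral]
  exact lintegral_dom_average_le hm hper _

lemma lintegral_enorm_sq {h : Pt → ℝ} (hint : IntegrableOn (fun p => h p ^ 2) Dom) :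
    ∫⁻ p in Dom, ‖h p‖ₑ ^ 2 = ENNReal.ofReal (∫ p in Dom, h p ^ 2) := by
  rw [ofReal_integral_eq_lintegral_ofReal hint (ae_of_all _ fun p => sq_nonneg _)]
  refine lintegral_congr fun p => ?_
  rw [← enorm_pow, Real.enorm_of_nonneg (sq_nonneg _)]

lemma integral_mollify_le (φ : ContDiffBump (0 : Pt)) {h : Pt → ℝ} (hm : Measurable h)
    (hper : PeriodicY h) (hint : IntegrableOn (fun p => h p ^ 2) Dom)
    (hc : Continuous (mollify φ h)) :
    IntegrableOn (fun p => mollify φ h p ^ 2) Dom ∧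
      ∫ p in Dom, mollify φ h p ^ 2 ≤ ∫ p in Dom, h p ^ 2 := by
  have h1 := lintegral_mollify_le φ hm hper
  rw [lintegral_enorm_sq hint] at h1
  have h2 : IntegrableOn (fun p => mollify φ h p ^ 2) Dom := by
    refine ⟨(hc.pow 2).aestronglyMeasurable, ?_⟩
    rw [HasFiniteIntegral]
    simp_rw [enorm_pow]
    exact h1.trans_lt ENNReal.ofReal_lt_top
  refine ⟨h2, ?_⟩
  rwa [lintegral_enorm_sq h2, ENNReal.ofReal_le_ofReal_iff
    (integral_nonneg fun p => sq_nonneg _)] at h1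

lemma measurable_gradx (u : Pt → ℝ) (i : Fin 3) : Measurable fun p => gradx u p i :=
  measurable_fderiv_apply_const ℝ u (ex i)

lemma measurable_grady (u : Pt → ℝ) : Measurable (grady u) :=
  measurable_fderiv_apply_const ℝ u ey

lemma measurable_gradSqX (u : Pt → ℝ) : Measurable (gradSqX u) :=
  Finset.measurable_sum _ fun i _ => (measurable_gradx u i).pow_const 2

lemma H1.integrable_gradSqX {u : Pt → ℝ} (hu : H1 u) : IntegrableOn (gradSqX u) Dom := by
  refine Integrable.mono' hu.memGrad (measurable_gradSqX u).aestronglyMeasurable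
    (ae_of_all _ fun p => ?_)
  rw [Real.norm_of_nonneg (gradSqX_nonneg u p), gradSq]
  exact le_add_of_nonneg_right (sq_nonneg _)

lemma H1.integrable_grady_sq {u : Pt → ℝ} (hu : H1 u) :
    IntegrableOn (fun p => grady u p ^ 2) Dom := by
  refine Integrable.mono' hu.memGrad ((measurable_grady u).pow_const 2).aestronglyMeasurable
    (ae_of_all _ fun p => ?_)
  rw [Real.norm_of_nonneg (sq_nonneg _), gradSq]
  exact le_add_of_nonneg_left (gradSqX_nonneg u p)

lemma H1.integrable_gradx_sq {u : Pt → ℝ} (hu : H1 u) (i : Fin 3) :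
    IntegrableOn (fun p => gradx u p i ^ 2) Dom := by
  refine Integrable.mono' hu.integrable_gradSqX
    ((measurable_gradx u i).pow_const 2).aestronglyMeasurable (ae_of_all _ fun p => ?_)
  rw [Real.norm_of_nonneg (sq_nonneg _), gradSqX]
  exact Finset.single_le_sum (f := fun i => gradx u p i ^ 2) (fun i _ => sq_nonneg _)
    (Finset.mem_univ i)

lemma PeriodicY.fderiv_apply {u : Pt → ℝ} (hu : PeriodicY u) (e : Pt) :
    PeriodicY fun p => fderiv ℝ u p e := by
  intro x y
  have h : (fun p : Pt => u (p + (0, 2 * π))) = u := by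
    funext p
    have : p + (0, 2 * π) = (p.1, p.2 + 2 * π) := by ext <;> simp
    rw [this, hu]
  have h2 : ((x, y) : Pt) + (0, 2 * π) = (x, y + 2 * π) := by ext <;> simp
  simp only
  rw [← h2, ← fderiv_comp_add_right (0, 2 * π), h]

/-- Multiplication by a dilated cutoff function in the `x` variables. -/
def cutoff (χ : ContDiffBump (0 : Pt3)) (δ : ℝ) (m : Pt → ℝ) (p : Pt) : ℝ := χ (δ • p.1) * m p

lemma hasFDerivAt_cutoff (χ : ContDiffBump (0 : Pt3)) (δ : ℝ) {m : Pt → ℝ} {p : Pt}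
    (hm : DifferentiableAt ℝ m p) :
    HasFDerivAt (cutoff χ δ m) (χ (δ • p.1) • fderiv ℝ m p
      + m p • (fderiv ℝ χ (δ • p.1)).comp (δ • ContinuousLinearMap.fst ℝ Pt3 ℝ)) p := by
  have h1 : HasFDerivAt (fun p : Pt => δ • p.1) (δ • ContinuousLinearMap.fst ℝ Pt3 ℝ) p :=
    (hasFDerivAt_fst (p := p)).const_smul δ
  have h2 : DifferentiableAt ℝ χ (δ • p.1) :=
    (χ.contDiff (n := 1)).differentiable one_ne_zero _
  exact (h2.hasFDerivAt.comp p h1).mul hm.hasFDerivAt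

lemma cutoff_nice (χ : ContDiffBump (0 : Pt3)) {δ : ℝ} (hδ : 0 < δ) {m : Pt → ℝ}
    (hm : ContDiff ℝ 1 m) (hper : PeriodicY m) : Nice (cutoff χ δ m) := by
  have hχ : ContDiff ℝ 1 χ := χ.contDiff
  refine ⟨(hχ.comp (contDiff_fst.const_smul δ)).mul hm, fun x y => ?_, χ.rOut / δ, fun p hp => ?_⟩
  · simp only [cutoff, hper x y]
  · rw [cutoff, χ.zero_of_le_dist, zero_mul]
    rw [dist_zero_right, norm_smul, Real.norm_of_nonneg hδ.le]
    rw [div_lt_iff₀ hδ] at hp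
    linarith

lemma gradx_cutoff (χ : ContDiffBump (0 : Pt3)) (δ : ℝ) {m : Pt → ℝ} {p : Pt}
    (hm : DifferentiableAt ℝ m p) (i : Fin 3) :
    gradx (cutoff χ δ m) p i = χ (δ • p.1) * gradx m p i + m p * (δ * grad3 χ (δ • p.1) i) := by
  rw [gradx, (hasFDerivAt_cutoff χ δ hm).fderiv]
  have : (ContinuousLinearMap.fst ℝ Pt3 ℝ) (ex i) = e3 i := rfl
  simp only [add_apply, smul_apply, ContinuousLinearMap.comp_apply, this, map_smul, smul_eq_mul]
  rfl

lemma grady_cutoff (χ : ContDiffBump (0 : Pt3)) (δ : ℝ) {m : Pt → ℝ} {p : Pt}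
    (hm : DifferentiableAt ℝ m p) :
    grady (cutoff χ δ m) p = χ (δ • p.1) * grady m p := by
  rw [grady, (hasFDerivAt_cutoff χ δ hm).fderiv]
  have : (ContinuousLinearMap.fst ℝ Pt3 ℝ) ey = 0 := rfl
  simp only [add_apply, smul_apply, ContinuousLinearMap.comp_apply, this, map_zero, smul_eq_mul,
    smul_zero, mul_zero, add_zero]
  rfl

lemma sq_mul_le_of_le_one {c a : ℝ} (h0 : 0 ≤ c) (h1 : c ≤ 1) : (c * a) ^ 2 ≤ a ^ 2 := by
  rw [mul_pow]
  exact mul_le_of_le_one_left (sq_nonneg a) (pow_le_one₀ h0 h1)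

lemma sq_add_le_weighted {δ : ℝ} (hδ : 0 < δ) (a b : ℝ) :
    (a + δ * b) ^ 2 ≤ (1 + δ) * a ^ 2 + (δ ^ 2 + δ) * b ^ 2 := by
  nlinarith [mul_nonneg hδ.le (sq_nonneg (a - b))]

lemma gradSqX_cutoff_le (χ : ContDiffBump (0 : Pt3)) {δ L : ℝ} (hδ : 0 < δ)
    (hL : ∀ x i, |grad3 χ x i| ≤ L) {m : Pt → ℝ} {p : Pt} (hm : DifferentiableAt ℝ m p) :
    gradSqX (cutoff χ δ m) p ≤ (1 + δ) * gradSqX m p + (δ ^ 2 + δ) * (3 * L ^ 2) * m p ^ 2 := by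
  have h : ∀ i, gradx (cutoff χ δ m) p i ^ 2
      ≤ (1 + δ) * gradx m p i ^ 2 + (δ ^ 2 + δ) * L ^ 2 * m p ^ 2 := by
    intro i
    have e : χ (δ • p.1) * gradx m p i + m p * (δ * grad3 χ (δ • p.1) i)
      = χ (δ • p.1) * gradx m p i + δ * (m p * grad3 χ (δ • p.1) i) := by ring
    rw [gradx_cutoff χ δ hm, e]
    refine (sq_add_le_weighted hδ _ _).trans ?_
    have h1 := sq_mul_le_of_le_one (a := gradx m p i) (χ.nonneg' (δ • p.1))
      (χ.le_one (x := δ • p.1))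
    have h2 : (m p * grad3 χ (δ • p.1) i) ^ 2 ≤ L ^ 2 * m p ^ 2 := by
      rw [mul_pow, mul_comm]
      gcongr ?_ * _
      rw [← sq_abs]
      exact pow_le_pow_left₀ (abs_nonneg _) (hL _ i) 2
    rw [mul_assoc (δ ^ 2 + δ)]
    gcongr
  calc gradSqX (cutoff χ δ m) p
      ≤ ∑ i : Fin 3, ((1 + δ) * gradx m p i ^ 2 + (δ ^ 2 + δ) * L ^ 2 * m p ^ 2) :=
        Finset.sum_le_sum fun i _ => h i
    _ = _ := by
        rw [Finset.sum_add_distrib, ← Finset.mul_sum, gradSqX]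
        simp only [Finset.sum_const, Finset.card_univ, Fintype.card_fin, nsmul_eq_mul]
        push_cast; ring

lemma exists_grad3_bound (χ : ContDiffBump (0 : Pt3)) : ∃ L : ℝ, ∀ x i, |grad3 χ x i| ≤ L := by
  have hχ : ContDiff ℝ 1 χ := χ.contDiff
  obtain ⟨C, hC⟩ := (χ.hasCompactSupport.fderiv ℝ).exists_bound_of_continuous
    (hχ.continuous_fderiv one_ne_zero)
  refine ⟨C * ∑ i, ‖e3 i‖, fun x i => ?_⟩
  have hC0 : 0 ≤ C := (norm_nonneg _).trans (hC x)
  calc |grad3 χ x i| ≤ ‖fderiv ℝ χ x‖ * ‖e3 i‖ := (fderiv ℝ χ x).le_opNorm _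
    _ ≤ C * ∑ i, ‖e3 i‖ := by
      gcongr
      · exact hC x
      · exact Finset.single_le_sum (f := fun i => ‖e3 i‖) (fun i _ => norm_nonneg _)
          (Finset.mem_univ i)

/-- Functions in `H1` are approximated by `Nice` ones without increasing the relevant norms. -/
lemma H1.exists_approx {u : Pt → ℝ} (hu : H1 u) : ∃ v : ℕ → Pt → ℝ, (∀ n, Nice (v n)) ∧
    (∀ p, Tendsto (fun n => v n p) atTop (𝓝 (u p))) ∧
    (∀ n, ∫ p in Dom, v n p ^ 2 ≤ ∫ p in Dom, u p ^ 2) ∧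
    (∀ n, ∫ p in Dom, grady (v n) p ^ 2 ≤ ∫ p in Dom, grady u p ^ 2) ∧
    ∃ a : ℕ → ℝ, Tendsto a atTop (𝓝 (∫ p in Dom, gradSqX u p)) ∧
      ∀ n, ∫ p in Dom, gradSqX (v n) p ≤ a n := by
  set δ : ℕ → ℝ := fun n => 1 / ((n : ℝ) + 1) with hδdef
  have hδ : ∀ n, 0 < δ n := fun n => by positivity
  have hδ0 : Tendsto δ atTop (𝓝 0) := tendsto_one_div_add_atTop_nhds_zero_nat
  set φ : ℕ → ContDiffBump (0 : Pt) := fun n => ⟨δ n / 2, δ n, half_pos (hδ n),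
    half_lt_self (hδ n)⟩ with hφ
  set χ : ContDiffBump (0 : Pt3) := ⟨1, 2, one_pos, one_lt_two⟩ with hχ
  obtain ⟨L, hL⟩ := exists_grad3_bound χ
  have hc : Continuous u := hu.diff.continuous
  have hul : LocallyIntegrable u volume := hc.locallyIntegrable
  have hpx : ∀ i, PeriodicY fun p => gradx u p i := fun i => hu.periodic.fderiv_apply (ex i)
  have hpy : PeriodicY (grady u) := hu.periodic.fderiv_apply ey
  have hlx : ∀ i, LocallyIntegrable (fun p => gradx u p i) volume := fun i =>
    locallyIntegrable_of_dom (measurable_gradx u i) (hpx i) (hu.integrable_gradx_sq i)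
  have hly : LocallyIntegrable (grady u) volume :=
    locallyIntegrable_of_dom (measurable_grady u) hpy hu.integrable_grady_sq
  have hC1 : ∀ n, ContDiff ℝ 1 (mollify (φ n) u) := fun n => contDiff_mollify _ hul
  have hmd : ∀ n, Differentiable ℝ (mollify (φ n) u) := fun n => (hC1 n).differentiable one_ne_zero
  have hgx : ∀ n i p, gradx (mollify (φ n) u) p i = mollify (φ n) (fun p => gradx u p i) p :=
    fun n i p => fderiv_mollify (φ n) hu.diff (ex i) (hlx i) p
  have hgy : ∀ n p, grady (mollify (φ n) u) p = mollify (φ n) (grady u) p :=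
    fun n p => fderiv_mollify (φ n) hu.diff ey hly p
  have bu : ∀ n, _ := fun n => integral_mollify_le (φ n) hc.measurable hu.periodic hu.memL2
    (hC1 n).continuous
  have bx : ∀ n i, _ := fun n i => integral_mollify_le (φ n) (measurable_gradx u i) (hpx i)
    (hu.integrable_gradx_sq i) (contDiff_mollify _ (hlx i)).continuous
  have bY : ∀ n, _ := fun n => integral_mollify_le (φ n) (measurable_grady u) hpy
    hu.integrable_grady_sq (contDiff_mollify _ hly).continuous
  have bX : ∀ n, IntegrableOn (gradSqX (mollify (φ n) u)) Dom ∧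
      ∫ p in Dom, gradSqX (mollify (φ n) u) p ≤ ∫ p in Dom, gradSqX u p := by
    intro n
    have e : gradSqX (mollify (φ n) u)
        = fun p => ∑ i, mollify (φ n) (fun p => gradx u p i) p ^ 2 := by
      funext p; simp only [gradSqX, hgx]
    rw [e]
    refine ⟨integrable_finsetSum _ fun i _ => (bx n i).1, ?_⟩
    rw [integral_finsetSum _ fun i _ => (bx n i).1]
    simp only [gradSqX]
    rw [integral_finsetSum _ fun i _ => hu.integrable_gradx_sq i]
    exact Finset.sum_le_sum fun i _ => (bx n i).2
  have hN : ∀ n, Nice (cutoff χ (δ n) (mollify (φ n) u)) := fun n =>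
    cutoff_nice χ (hδ n) (hC1 n) (mollify_periodic _ hu.periodic)
  refine ⟨fun n => cutoff χ (δ n) (mollify (φ n) u), hN, fun p => ?_, fun n => ?_, fun n => ?_,
    fun n => (1 + δ n) * (∫ p in Dom, gradSqX u p)
      + (δ n ^ 2 + δ n) * (3 * L ^ 2) * ∫ p in Dom, u p ^ 2, ?_, fun n => ?_⟩
  · have h1 : Tendsto (fun n => mollify (φ n) u p) atTop (𝓝 (u p)) :=
      ContDiffBump.convolution_tendsto_right_of_continuous hδ0 hc p
    have h2 : Tendsto (fun n => χ (δ n • p.1)) atTop (𝓝 (χ 0)) := by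
      have := hδ0.smul_const p.1
      rw [zero_smul] at this
      exact (χ.continuous.tendsto 0).comp this
    rw [χ.one_of_mem_closedBall (by simp [hχ])] at h2
    simpa [cutoff] using h2.mul h1
  · refine le_trans ?_ (bu n).2
    exact integral_mono ((hN n).integrable_pow two_ne_zero) (bu n).1 fun p =>
      sq_mul_le_of_le_one χ.nonneg χ.le_one
  · refine le_trans ?_ (bY n).2
    refine integral_mono (hN n).integrable_grady_sq (bY n).1 fun p => ?_
    simp only
    rw [grady_cutoff _ _ (hmd n p), hgy]
    exact sq_mul_le_of_le_one χ.nonneg χ.le_one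
  · have : Tendsto (fun n => (1 + δ n) * (∫ p in Dom, gradSqX u p)
      + (δ n ^ 2 + δ n) * (3 * L ^ 2) * ∫ p in Dom, u p ^ 2) atTop
      (𝓝 ((1 + 0) * (∫ p in Dom, gradSqX u p)
      + (0 ^ 2 + 0) * (3 * L ^ 2) * ∫ p in Dom, u p ^ 2)) :=
      ((hδ0.const_add 1).mul_const _).add
        ((((hδ0.pow 2).add hδ0).mul_const _).mul_const _)
    simpa using this
  · have hδn := hδ n
    calc ∫ p in Dom, gradSqX (cutoff χ (δ n) (mollify (φ n) u)) p
        ≤ ∫ p in Dom, ((1 + δ n) * gradSqX (mollify (φ n) u) p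
          + (δ n ^ 2 + δ n) * (3 * L ^ 2) * mollify (φ n) u p ^ 2) :=
          integral_mono (hN n).integrable_gradSqX (((bX n).1.const_mul _).add
            ((bu n).1.const_mul _)) fun p => gradSqX_cutoff_le χ (hδ n) hL (hmd n p)
      _ = (1 + δ n) * (∫ p in Dom, gradSqX (mollify (φ n) u) p)
          + (δ n ^ 2 + δ n) * (3 * L ^ 2) * ∫ p in Dom, mollify (φ n) u p ^ 2 := by
          rw [integral_add ((bX n).1.const_mul _) ((bu n).1.const_mul _), integral_const_mul,
            integral_const_mul]
      _ ≤ _ := by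
          have h1 := (bX n).2
          have h2 := (bu n).2
          exact add_le_add (mul_le_mul_of_nonneg_left h1 (by positivity))
            (mul_le_mul_of_nonneg_left h2 (by positivity))

lemma nonlin_nonneg (u v : Pt → ℝ) (p : Pt) : 0 ≤ nonlin u v p := by
  unfold nonlin; positivity

lemma integrable_nonlin {α : Type*} [MeasurableSpace α] {m : Measure α} {f g : α → ℝ}
    (hf : AEStronglyMeasurable f m) (hg : AEStronglyMeasurable g m)
    (hf4 : Integrable (fun x => f x ^ 4) m) (hg4 : Integrable (fun x => g x ^ 4) m) :
    Integrable (fun x => f x ^ 4 + 2 * f x ^ 2 * g x ^ 2 + g x ^ 4) m := by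
  refine Integrable.mono' ((hf4.add hg4).const_mul 2) ?_ (ae_of_all _ fun x => ?_)
  · exact ((hf.pow 4).add (((hf.pow 2).const_mul 2).mul (hg.pow 2))).add (hg.pow 4)
  · rw [Real.norm_of_nonneg (by positivity)]
    simp only [Pi.add_apply]
    nlinarith [sq_nonneg (f x ^ 2 - g x ^ 2)]

lemma H1.integrable_nonlin {u v : Pt → ℝ} (hu : H1 u) (hv : H1 v) :
    IntegrableOn (nonlin u v) Dom :=
  Waveguide.integrable_nonlin hu.diff.continuous.aestronglyMeasurable
    hv.diff.continuous.aestronglyMeasurable hu.memL4 hv.memL4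

lemma Nice.integrable_nonlin {u v : Pt → ℝ} (hu : Nice u) (hv : Nice v) :
    IntegrableOn (nonlin u v) Dom :=
  Waveguide.integrable_nonlin hu.continuous.aestronglyMeasurable
    hv.continuous.aestronglyMeasurable (hu.integrable_pow four_ne_zero)
    (hv.integrable_pow four_ne_zero)

lemma integral_le_of_tendsto {α : Type*} [MeasurableSpace α] {m : Measure α} {F : ℕ → α → ℝ}
    {f : α → ℝ} (hF : ∀ n, Integrable (F n) m) (hF0 : ∀ n x, 0 ≤ F n x)
    (hf : ∀ x, 0 ≤ f x) (hlim : ∀ x, Tendsto (fun n => F n x) atTop (𝓝 (f x)))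
    (hfm : AEStronglyMeasurable f m)
    {b : ℕ → ℝ} {c : ℝ} (hb : ∀ n, ∫ x, F n x ∂m ≤ b n) (hc : Tendsto b atTop (𝓝 c)) :
    ∫ x, f x ∂m ≤ c := by
  have hb0 : ∀ n, 0 ≤ b n := fun n => (integral_nonneg (hF0 n)).trans (hb n)
  have hc0 : 0 ≤ c := ge_of_tendsto' hc hb0
  rw [integral_eq_lintegral_of_nonneg_ae (ae_of_all _ hf) hfm]
  refine ENNReal.toReal_le_of_le_ofReal hc0 ?_
  calc ∫⁻ x, ENNReal.ofReal (f x) ∂m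
      = ∫⁻ x, liminf (fun n => ENNReal.ofReal (F n x)) atTop ∂m := by
        refine lintegral_congr fun x => ?_
        exact ((ENNReal.continuous_ofReal.tendsto _).comp (hlim x)).liminf_eq.symm
    _ ≤ liminf (fun n => ∫⁻ x, ENNReal.ofReal (F n x) ∂m) atTop :=
        lintegral_liminf_le' fun n => (hF n).aemeasurable.ennreal_ofReal
    _ ≤ liminf (fun n => ENNReal.ofReal (b n)) atTop := by
        refine liminf_le_liminf (Eventually.of_forall fun n => ?_)
        rw [← ofReal_integral_eq_lintegral_ofReal (hF n) (ae_of_all _ (hF0 n))]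
        exact ENNReal.ofReal_le_ofReal (hb n)
    _ = ENNReal.ofReal c := ((ENNReal.continuous_ofReal.tendsto _).comp hc).liminf_eq

lemma exists_waveguide_inequality : ∃ C : ℝ, 0 ≤ C ∧ ∀ κ : ℝ, 0 < κ → GagliardoNirenberg κ →
    ∀ u v : Pt → ℝ, H1 u → H1 v → (∫ p in Dom, u p ^ 2) + (∫ p in Dom, v p ^ 2) ≤ 2 →
    ∫ p in Dom, nonlin u v p
      ≤ κ * (((∫ p in Dom, gradSqX u p) + ∫ p in Dom, gradSqX v p)
          * √((∫ p in Dom, gradSqX u p) + ∫ p in Dom, gradSqX v p))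
        * (1 + C / κ ^ 2 * ((∫ p in Dom, grady u p ^ 2) + ∫ p in Dom, grady v p ^ 2)) := by
  obtain ⟨C, hC0, hC⟩ := exists_nice_inequality
  refine ⟨C, hC0, fun κ hκ hGN u v hu hv hm => ?_⟩
  obtain ⟨f, hf, hfl, hfm, hfy, a, ha, hfa⟩ := hu.exists_approx
  obtain ⟨g, hg, hgl, hgm, hgy, b, hb, hgb⟩ := hv.exists_approx
  have hlim : ∀ p, Tendsto (fun n => nonlin (f n) (g n) p) atTop (𝓝 (nonlin u v p)) := fun p =>
    (((hfl p).pow 4).add ((((hfl p).pow 2).const_mul 2).mul ((hgl p).pow 2))).add ((hgl p).pow 4)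
  refine integral_le_of_tendsto (fun n => (hf n).integrable_nonlin (hg n))
    (fun n => nonlin_nonneg _ _) (nonlin_nonneg _ _) hlim
    (hu.integrable_nonlin hv).aestronglyMeasurable
    (b := fun n => κ * ((a n + b n) * √(a n + b n))
        * (1 + C / κ ^ 2 * ((∫ p in Dom, grady u p ^ 2) + ∫ p in Dom, grady v p ^ 2)))
    (fun n => ?_) ?_
  · refine (hC κ hκ hGN (f n) (g n) (hf n) (hg n)
      ((add_le_add (hfm n) (hgm n)).trans hm)).trans ?_
    have h1 := add_le_add (hfa n) (hgb n)
    have h2 := add_le_add (hfy n) (hgy n)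
    have h0 : 0 ≤ (∫ p in Dom, gradSqX (f n) p) + ∫ p in Dom, gradSqX (g n) p :=
      add_nonneg (integral_nonneg (gradSqX_nonneg _)) (integral_nonneg (gradSqX_nonneg _))
    have h3 : 0 ≤ (∫ p in Dom, grady (f n) p ^ 2) + ∫ p in Dom, grady (g n) p ^ 2 :=
      add_nonneg (integral_nonneg fun _ => sq_nonneg _) (integral_nonneg fun _ => sq_nonneg _)
    have h4 := h0.trans h1
    gcongr
  · have hab := ha.add hb
    exact ((hab.mul (hab.sqrt)).const_mul κ).mul_const _

/-- The dilation `x ↦ b f(τ x)`. -/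
def dilate (b τ : ℝ) (f : Pt3 → ℝ) (x : Pt3) : ℝ := b * f (τ • x)

lemma hasFDerivAt_dilate {b τ : ℝ} {f : Pt3 → ℝ} (hf : Differentiable ℝ f) (x : Pt3) :
    HasFDerivAt (dilate b τ f) (b • τ • fderiv ℝ f (τ • x)) x := by
  have h := ((hf (τ • x)).hasFDerivAt.comp x ((hasFDerivAt_id x).const_smul τ)).const_mul b
  refine h.congr_fderiv ?_
  ext v
  simp

lemma gradSq3_dilate {b τ : ℝ} {f : Pt3 → ℝ} (hf : Differentiable ℝ f) (x : Pt3) :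
    gradSq3 (dilate b τ f) x = b ^ 2 * τ ^ 2 * gradSq3 f (τ • x) := by
  simp only [gradSq3, grad3, (hasFDerivAt_dilate hf x).fderiv, Finset.mul_sum]
  refine Finset.sum_congr rfl fun i _ => ?_
  simp only [smul_apply, smul_eq_mul]
  ring

lemma integral_comp_dilation {τ : ℝ} (hτ : 0 < τ) (c : ℝ) (F : Pt3 → ℝ) :
    ∫ x, c * F (τ • x) = c / τ ^ 3 * ∫ x, F x := by
  rw [integral_const_mul, Measure.integral_comp_smul_of_nonneg _ _ _ (hR := hτ.le)]
  simp
  ring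

lemma H1R3.dilate {f : Pt3 → ℝ} (hf : H1R3 f) (b : ℝ) {τ : ℝ} (hτ : 0 < τ) :
    H1R3 (dilate b τ f) where
  diff x := (hasFDerivAt_dilate hf.diff x).differentiableAt
  memL2 := by
    simpa only [Waveguide.dilate, mul_pow] using (hf.memL2.comp_smul hτ.ne').const_mul (b ^ 2)
  memGrad := by
    simpa only [gradSq3_dilate hf.diff] using
      (hf.memGrad.comp_smul hτ.ne').const_mul (b ^ 2 * τ ^ 2)
  memL4 := by
    simpa only [Waveguide.dilate, mul_pow] using (hf.memL4.comp_smul hτ.ne').const_mul (b ^ 4)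

lemma integral_dilate_sq {b τ : ℝ} (hτ : 0 < τ) (f : Pt3 → ℝ) :
    ∫ x, dilate b τ f x ^ 2 = b ^ 2 / τ ^ 3 * ∫ x, f x ^ 2 := by
  rw [← integral_comp_dilation hτ _ fun x => f x ^ 2]
  simp only [dilate, mul_pow]

lemma integral_gradSq3_dilate {b τ : ℝ} (hτ : 0 < τ) {f : Pt3 → ℝ} (hf : Differentiable ℝ f) :
    ∫ x, gradSq3 (dilate b τ f) x = b ^ 2 / τ * ∫ x, gradSq3 f x := by
  simp only [gradSq3_dilate hf]
  rw [integral_comp_dilation hτ]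
  field_simp

lemma integral_nonlin3_dilate {b τ : ℝ} (hτ : 0 < τ) (f g : Pt3 → ℝ) :
    ∫ x, nonlin3 (dilate b τ f) (dilate b τ g) x = b ^ 4 / τ ^ 3 * ∫ x, nonlin3 f g x := by
  rw [← integral_comp_dilation hτ]
  refine integral_congr_ae (ae_of_all _ fun x => ?_)
  simp only [nonlin3, dilate]
  ring

lemma nonlin3_nonneg (f g : Pt3 → ℝ) (x : Pt3) : 0 ≤ nonlin3 f g x := by
  unfold nonlin3; positivity

lemma integral_sq_eq_zero_of_nonlin {α : Type*} [MeasurableSpace α] {m : Measure α} {f g : α → ℝ}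
    (hi : Integrable (fun x => f x ^ 4 + 2 * f x ^ 2 * g x ^ 2 + g x ^ 4) m)
    (h0 : ∫ x, (f x ^ 4 + 2 * f x ^ 2 * g x ^ 2 + g x ^ 4) ∂m = 0) :
    ∫ x, f x ^ 2 ∂m = 0 := by
  rw [integral_eq_zero_iff_of_nonneg (fun x => by simp only [Pi.zero_apply]; positivity) hi] at h0
  refine integral_eq_zero_of_ae ?_
  filter_upwards [h0] with x hx
  simp only [Pi.zero_apply] at hx ⊢
  have h1 : 0 ≤ 2 * f x ^ 2 * g x ^ 2 := by positivity
  have h2 : 0 ≤ g x ^ 4 := by positivity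
  have h3 : f x ^ 2 * f x ^ 2 ≤ 0 := by nlinarith
  nlinarith [sq_nonneg (f x)]

/-- The admissible energies in the definition of `mhat`. -/
def mhatSet (ρ : ℝ) : Set ℝ :=
  {c | ∃ u v : Pt3 → ℝ, H1R3 u ∧ H1R3 v ∧ l2R3 u = ρ ∧ l2R3 v = ρ ∧ Qhat u v = 0 ∧ Ihat u v = c}

lemma H1R3.integral_gradSq3_add {u v : Pt3 → ℝ} (hu : H1R3 u) (hv : H1R3 v) :
    ∫ x, (gradSq3 u x + gradSq3 v x) = (∫ x, gradSq3 u x) + ∫ x, gradSq3 v x :=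
  integral_add hu.memGrad hv.memGrad

lemma Ihat_eq_of_Qhat_eq_zero {u v : Pt3 → ℝ} (h : Qhat u v = 0) :
    Ihat u v = (∫ x, (gradSq3 u x + gradSq3 v x)) / 6 := by
  unfold Qhat at h
  unfold Ihat
  linarith

lemma mhatSet_nonneg {ρ c : ℝ} (hc : c ∈ mhatSet ρ) : 0 ≤ c := by
  obtain ⟨u, v, -, -, -, -, hQ, rfl⟩ := hc
  rw [Ihat_eq_of_Qhat_eq_zero hQ]
  exact div_nonneg (integral_nonneg fun x => add_nonneg (gradSq3_nonneg u x) (gradSq3_nonneg v x))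
    (by norm_num)

lemma bddBelow_mhatSet (ρ : ℝ) : BddBelow (mhatSet ρ) := ⟨0, fun _ hc => mhatSet_nonneg hc⟩

lemma mem_mhatSet {ρ : ℝ} {f g : Pt3 → ℝ} (hf : H1R3 f) (hg : H1R3 g) (hfm : l2R3 f = ρ)
    (hgm : l2R3 g = ρ) (hA : 0 < (∫ x, gradSq3 f x) + ∫ x, gradSq3 g x)
    (hN : 0 < ∫ x, nonlin3 f g x) :
    8 / 27 * ((∫ x, gradSq3 f x) + ∫ x, gradSq3 g x) ^ 3 / (∫ x, nonlin3 f g x) ^ 2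
      ∈ mhatSet ρ := by
  set A := (∫ x, gradSq3 f x) + ∫ x, gradSq3 g x with hAd
  set N := ∫ x, nonlin3 f g x with hNd
  set τ := 4 * A / (3 * N) with hτd
  have hτ : 0 < τ := by positivity
  set b := √(τ ^ 3) with hb
  have hb2 : b ^ 2 = τ ^ 3 := Real.sq_sqrt (by positivity)
  have hb4 : b ^ 4 = τ ^ 6 := by rw [show b ^ 4 = (b ^ 2) ^ 2 by ring, hb2]; ring
  have hA' : ∫ x, (gradSq3 (dilate b τ f) x + gradSq3 (dilate b τ g) x) = τ ^ 2 * A := by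
    rw [(hf.dilate b hτ).integral_gradSq3_add (hg.dilate b hτ), integral_gradSq3_dilate hτ hf.diff,
      integral_gradSq3_dilate hτ hg.diff, hb2, hAd]
    field_simp
  have hN' : ∫ x, nonlin3 (dilate b τ f) (dilate b τ g) x = τ ^ 3 * N := by
    rw [integral_nonlin3_dilate hτ, hb4, ← hNd]
    field_simp
  have hτA : τ * N = 4 / 3 * A := by rw [hτd]; field_simp
  have hm : ∀ w : Pt3 → ℝ, l2R3 (dilate b τ w) = l2R3 w := fun w => by
    rw [l2R3, integral_dilate_sq hτ, hb2, div_self (by positivity), one_mul, l2R3]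
  have hQ : Qhat (dilate b τ f) (dilate b τ g) = 0 := by
    rw [Qhat, hA', hN', show τ ^ 3 * N = τ ^ 2 * (τ * N) by ring, hτA]
    ring
  refine ⟨dilate b τ f, dilate b τ g, hf.dilate b hτ, hg.dilate b hτ, (hm f).trans hfm,
    (hm g).trans hgm, hQ, ?_⟩
  rw [Ihat_eq_of_Qhat_eq_zero hQ, hA', hτd]
  field_simp
  ring

/-- The linear combination `a f + b g`. -/
def mix (a b : ℝ) (f g : Pt3 → ℝ) (x : Pt3) : ℝ := a * f x + b * g x

lemma grad3_mix {a b : ℝ} {f g : Pt3 → ℝ} (hf : Differentiable ℝ f) (hg : Differentiable ℝ g)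
    (x : Pt3) (i : Fin 3) : grad3 (mix a b f g) x i = a * grad3 f x i + b * grad3 g x i := by
  have h : HasFDerivAt (mix a b f g) (a • fderiv ℝ f x + b • fderiv ℝ g x) x :=
    ((hf x).hasFDerivAt.const_mul a).add ((hg x).hasFDerivAt.const_mul b)
  simp [grad3, h.fderiv]

lemma integrable_mul_of_sq {α : Type*} [MeasurableSpace α] {m : Measure α} {f g : α → ℝ}
    (hf : AEStronglyMeasurable f m) (hg : AEStronglyMeasurable g m)
    (hf2 : Integrable (fun x => f x ^ 2) m) (hg2 : Integrable (fun x => g x ^ 2) m) :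
    Integrable (fun x => f x * g x) m := by
  refine Integrable.mono' (hf2.add hg2) (hf.mul hg) (ae_of_all _ fun x => ?_)
  rw [Real.norm_eq_abs, abs_mul]
  simp only [Pi.add_apply]
  nlinarith [sq_nonneg (|f x| - |g x|), sq_abs (f x), sq_abs (g x), abs_nonneg (f x),
    abs_nonneg (g x)]

lemma measurable_grad3 (f : Pt3 → ℝ) (i : Fin 3) : Measurable fun x => grad3 f x i :=
  measurable_fderiv_apply_const ℝ f (e3 i)

lemma measurable_gradSq3 (f : Pt3 → ℝ) : Measurable (gradSq3 f) :=
  Finset.measurable_sum _ fun i _ => (measurable_grad3 f i).pow_const 2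

lemma H1R3.mix {f g : Pt3 → ℝ} (hf : H1R3 f) (hg : H1R3 g) (a b : ℝ) : H1R3 (mix a b f g) := by
  have hd : Differentiable ℝ (Waveguide.mix a b f g) :=
    (hf.diff.const_mul a).add (hg.diff.const_mul b)
  refine ⟨hd, ?_, ?_, ?_⟩
  · refine Integrable.mono' ((hf.memL2.const_mul (2 * a ^ 2)).add (hg.memL2.const_mul (2 * b ^ 2)))
      (hd.continuous.pow 2).aestronglyMeasurable (ae_of_all _ fun x => ?_)
    rw [Real.norm_of_nonneg (sq_nonneg _)]
    simp only [Waveguide.mix, Pi.add_apply]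
    nlinarith [sq_nonneg (a * f x - b * g x)]
  · refine Integrable.mono' ((hf.memGrad.const_mul (2 * a ^ 2)).add
      (hg.memGrad.const_mul (2 * b ^ 2))) (measurable_gradSq3 _).aestronglyMeasurable
      (ae_of_all _ fun x => ?_)
    rw [Real.norm_of_nonneg (gradSq3_nonneg _ _)]
    simp only [gradSq3, Pi.add_apply, Finset.mul_sum, ← Finset.sum_add_distrib,
      grad3_mix hf.diff hg.diff]
    exact Finset.sum_le_sum fun i _ => by
      nlinarith [sq_nonneg (a * grad3 f x i - b * grad3 g x i)]
  · refine Integrable.mono' ((hf.memL4.const_mul (8 * a ^ 4)).add (hg.memL4.const_mul (8 * b ^ 4)))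
      (hd.continuous.pow 4).aestronglyMeasurable (ae_of_all _ fun x => ?_)
    rw [Real.norm_of_nonneg (by positivity)]
    simp only [Waveguide.mix, Pi.add_apply]
    have h1 : (a * f x + b * g x) ^ 2 ≤ 2 * ((a * f x) ^ 2 + (b * g x) ^ 2) := by
      nlinarith [sq_nonneg (a * f x - b * g x)]
    have h2 : ((a * f x + b * g x) ^ 2) ^ 2 ≤ (2 * ((a * f x) ^ 2 + (b * g x) ^ 2)) ^ 2 := by
      gcongr
    nlinarith [sq_nonneg ((a * f x) ^ 2 - (b * g x) ^ 2)]

lemma H1R3.integrable_mul {f g : Pt3 → ℝ} (hf : H1R3 f) (hg : H1R3 g) :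
    Integrable fun x => f x * g x :=
  integrable_mul_of_sq hf.diff.continuous.aestronglyMeasurable
    hg.diff.continuous.aestronglyMeasurable hf.memL2 hg.memL2

lemma H1R3.integral_mix_sq {f g : Pt3 → ℝ} (hf : H1R3 f) (hg : H1R3 g) (a b : ℝ) :
    ∫ x, Waveguide.mix a b f g x ^ 2
      = a ^ 2 * (∫ x, f x ^ 2) + 2 * a * b * (∫ x, f x * g x) + b ^ 2 * ∫ x, g x ^ 2 := by
  have e : ∀ x, Waveguide.mix a b f g x ^ 2
      = a ^ 2 * f x ^ 2 + 2 * a * b * (f x * g x) + b ^ 2 * g x ^ 2 := fun x => by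
    unfold Waveguide.mix; ring
  have h1 : Integrable fun x => a ^ 2 * f x ^ 2 := hf.memL2.const_mul _
  have h2 : Integrable fun x => 2 * a * b * (f x * g x) := (hf.integrable_mul hg).const_mul _
  have h3 : Integrable fun x => b ^ 2 * g x ^ 2 := hg.memL2.const_mul _
  have h12 : Integrable fun x => a ^ 2 * f x ^ 2 + 2 * a * b * (f x * g x) := h1.add h2
  simp only [e]
  rw [integral_add h12 h3, integral_add h1 h2, integral_const_mul, integral_const_mul,
    integral_const_mul]

lemma exists_rotation (p q r : ℝ) : ∃ a b : ℝ, a ^ 2 + b ^ 2 = 1 ∧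
    a ^ 2 * p + 2 * a * b * q + b ^ 2 * r = (p + r) / 2 := by
  have hc : ContinuousOn (fun t : ℝ => cos t ^ 2 * p + 2 * cos t * sin t * q + sin t ^ 2 * r)
      (Set.uIcc 0 (π / 2)) := by fun_prop
  have h := intermediate_value_uIcc hc
  have hm : (p + r) / 2 ∈ Set.uIcc
      (cos 0 ^ 2 * p + 2 * cos 0 * sin 0 * q + sin 0 ^ 2 * r)
      (cos (π / 2) ^ 2 * p + 2 * cos (π / 2) * sin (π / 2) * q + sin (π / 2) ^ 2 * r) := by
    simp only [cos_zero, sin_zero, cos_pi_div_two, sin_pi_div_two]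
    norm_num
    rw [Set.mem_uIcc]
    rcases le_total p r with h | h
    · left; constructor <;> linarith
    · right; constructor <;> linarith
  obtain ⟨t, -, ht⟩ := h hm
  exact ⟨cos t, sin t, cos_sq_add_sin_sq t, ht⟩

lemma exists_equal_mass {f g : Pt3 → ℝ} (hf : H1R3 f) (hg : H1R3 g) :
    ∃ f' g' : Pt3 → ℝ, H1R3 f' ∧ H1R3 g' ∧
      ∫ x, f' x ^ 2 = ((∫ x, f x ^ 2) + ∫ x, g x ^ 2) / 2 ∧
      ∫ x, g' x ^ 2 = ((∫ x, f x ^ 2) + ∫ x, g x ^ 2) / 2 ∧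
      (∫ x, gradSq3 f' x) + (∫ x, gradSq3 g' x) = (∫ x, gradSq3 f x) + (∫ x, gradSq3 g x) ∧
      ∫ x, nonlin3 f' g' x = ∫ x, nonlin3 f g x := by
  obtain ⟨a, b, hab, hm⟩ := exists_rotation (∫ x, f x ^ 2) (∫ x, f x * g x) (∫ x, g x ^ 2)
  have h1 := hf.mix hg a b
  have h2 := hf.mix hg (-b) a
  refine ⟨_, _, h1, h2, ?_, ?_, ?_, ?_⟩
  · rw [hf.integral_mix_sq hg, hm]
  · rw [hf.integral_mix_sq hg]
    have ha : a ^ 2 = 1 - b ^ 2 := by linarith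
    rw [ha] at hm ⊢
    linarith
  · rw [← h1.integral_gradSq3_add h2, ← hf.integral_gradSq3_add hg]
    refine integral_congr_ae (ae_of_all _ fun x => ?_)
    simp only [gradSq3, grad3_mix hf.diff hg.diff, ← Finset.sum_add_distrib]
    refine Finset.sum_congr rfl fun i _ => ?_
    linear_combination (grad3 f x i ^ 2 + grad3 g x i ^ 2) * hab
  · refine integral_congr_ae (ae_of_all _ fun x => ?_)
    have e : mix a b f g x ^ 2 + mix (-b) a f g x ^ 2 = f x ^ 2 + g x ^ 2 := by
      unfold mix
      linear_combination (f x ^ 2 + g x ^ 2) * hab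
    have e' : ∀ s t : ℝ, s ^ 4 + 2 * s ^ 2 * t ^ 2 + t ^ 4 = (s ^ 2 + t ^ 2) ^ 2 := fun s t => by
      ring
    simp only [nonlin3, e', e]

lemma continuous_grad3 {f : Pt3 → ℝ} (hf : ContDiff ℝ 1 f) (i : Fin 3) :
    Continuous fun x => grad3 f x i :=
  (hf.continuous_fderiv one_ne_zero).clm_apply continuous_const

lemma hasCompactSupport_of_norm_bounded {f : Pt3 → ℝ} (h : ∃ R : ℝ, ∀ x, R < ‖x‖ → f x = 0) :
    HasCompactSupport f := by
  obtain ⟨R, hR⟩ := h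
  refine HasCompactSupport.intro (isCompact_closedBall (0 : Pt3) R) fun x hx => hR x ?_
  simpa using hx

lemma hasCompactSupport_gradSq3 {f : Pt3 → ℝ} (hs : HasCompactSupport f) :
    HasCompactSupport (gradSq3 f) :=
  HasCompactSupport.intro hs fun x hx => by
    simp [gradSq3, grad3, fderiv_of_notMem_tsupport (𝕜 := ℝ) hx]

lemma hasCompactSupport_pow {f : Pt3 → ℝ} (hs : HasCompactSupport f) {n : ℕ} (hn : n ≠ 0) :
    HasCompactSupport fun x => f x ^ n :=
  HasCompactSupport.intro hs fun x hx => by simp [image_eq_zero_of_notMem_tsupport hx, hn]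

lemma continuous_gradSq3 {f : Pt3 → ℝ} (hf : ContDiff ℝ 1 f) : Continuous (gradSq3 f) :=
  continuous_finsetSum _ fun i _ => (continuous_grad3 hf i).pow 2

lemma H1R3_of_contDiff {f : Pt3 → ℝ} (hf : ContDiff ℝ 1 f) (hs : HasCompactSupport f) :
    H1R3 f where
  diff := hf.differentiable one_ne_zero
  memL2 := (hf.continuous.pow 2).integrable_of_hasCompactSupport
    (hasCompactSupport_pow hs two_ne_zero)
  memL4 := (hf.continuous.pow 4).integrable_of_hasCompactSupport
    (hasCompactSupport_pow hs four_ne_zero)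
  memGrad := (continuous_gradSq3 hf).integrable_of_hasCompactSupport (hasCompactSupport_gradSq3 hs)

lemma exists_quartic_bound : ∃ K : ℝ, 0 < K ∧ ∀ f : Pt3 → ℝ, ContDiff ℝ 1 f → HasCompactSupport f →
    2 * π * (∫ x, f x ^ 2) ≤ 2 →
    ∫ x, f x ^ 4 ≤ K * ((∫ x, gradSq3 f x) * √(∫ x, gradSq3 f x)) := by
  obtain ⟨C, hC⟩ := exists_sobolev_six
  refine ⟨√(C + 1), by positivity, fun f hf hs hm => ?_⟩
  have hH := H1R3_of_contDiff hf hs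
  have hA0 : 0 ≤ ∫ x, gradSq3 f x := integral_nonneg fun x => gradSq3_nonneg f x
  have hcs := lintegral_cauchy_schwarz (volume : Measure Pt3) (f := fun x => ‖f x‖ₑ)
    (g := fun x => ‖f x‖ₑ ^ 3) hf.continuous.enorm.aemeasurable
    (hf.continuous.enorm.aemeasurable.pow_const 3)
  have e4 : ∫⁻ x, ‖f x‖ₑ * ‖f x‖ₑ ^ 3 = ENNReal.ofReal (∫ x, f x ^ 4) := by
    rw [ofReal_integral_eq_lintegral_ofReal hH.memL4 (ae_of_all _ fun x => by positivity)]
    refine lintegral_congr fun x => ?_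
    rw [← pow_succ', ← ofReal_norm, ← ENNReal.ofReal_pow (norm_nonneg _), Real.norm_eq_abs,
      Even.pow_abs (by decide)]
  have e2 : ∫⁻ x, ‖f x‖ₑ ^ 2 ≤ 1 := by
    have : ∫⁻ x, ‖f x‖ₑ ^ 2 = ENNReal.ofReal (∫ x, f x ^ 2) := by
      rw [ofReal_integral_eq_lintegral_ofReal hH.memL2 (ae_of_all _ fun x => by positivity)]
      refine lintegral_congr fun x => ?_
      rw [← ofReal_norm, ← ENNReal.ofReal_pow (norm_nonneg _), Real.norm_eq_abs, sq_abs]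
    rw [this, ENNReal.ofReal_le_one]
    have hM0 : 0 ≤ ∫ x, f x ^ 2 := integral_nonneg fun x => sq_nonneg _
    nlinarith [Real.pi_gt_three]
  have e6 : ∫⁻ x, (‖f x‖ₑ ^ 3) ^ 2 ≤ ENNReal.ofReal ((C + 1) * (∫ x, gradSq3 f x) ^ 3) := by
    simp only [← pow_mul]
    refine (hC f hf hs).trans ?_
    rw [ENNReal.ofReal_mul (by positivity), ENNReal.ofReal_pow hA0,
      ofReal_integral_eq_lintegral_ofReal hH.memGrad (ae_of_all _ fun x => gradSq3_nonneg f x)]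
    gcongr
    rw [ENNReal.ofReal_add (by positivity) zero_le_one]
    simp
  rw [e4] at hcs
  have h1 : ENNReal.ofReal (∫ x, f x ^ 4)
      ≤ ENNReal.ofReal (√((C + 1) * (∫ x, gradSq3 f x) ^ 3)) := by
    rw [Real.sqrt_eq_rpow, ← ENNReal.ofReal_rpow_of_nonneg (by positivity) (by norm_num)]
    refine hcs.trans ?_
    calc _ ≤ (1 : ℝ≥0∞) ^ (1 / 2 : ℝ)
        * (ENNReal.ofReal ((C + 1) * (∫ x, gradSq3 f x) ^ 3)) ^ (1 / 2 : ℝ) := by gcongr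
      _ = _ := by simp
  have h2 := (ENNReal.ofReal_le_ofReal_iff (Real.sqrt_nonneg _)).1 h1
  rwa [Real.sqrt_mul (by positivity), show (∫ x, gradSq3 f x) ^ 3
    = (∫ x, gradSq3 f x) ^ 2 * ∫ x, gradSq3 f x by ring, Real.sqrt_mul (by positivity),
    Real.sqrt_sq hA0] at h2

lemma mul_sqrt_mono {s t : ℝ} (hs : 0 ≤ s) (h : s ≤ t) : s * √s ≤ t * √t :=
  mul_le_mul h (Real.sqrt_le_sqrt h) (Real.sqrt_nonneg _) (hs.trans h)

lemma exists_gagliardoNirenberg : ∃ κ : ℝ, 0 < κ ∧ GagliardoNirenberg κ := by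
  obtain ⟨K, hK, h⟩ := exists_quartic_bound
  refine ⟨8 * π * K, by positivity, fun f g hf hg hfb hgb hm => ?_⟩
  have hfs := hasCompactSupport_of_norm_bounded hfb
  have hgs := hasCompactSupport_of_norm_bounded hgb
  have hF := H1R3_of_contDiff hf hfs
  have hG := H1R3_of_contDiff hg hgs
  have hMf : 0 ≤ 2 * π * ∫ x, f x ^ 2 :=
    mul_nonneg two_pi_pos.le (integral_nonneg fun x => sq_nonneg _)
  have hMg : 0 ≤ 2 * π * ∫ x, g x ^ 2 :=
    mul_nonneg two_pi_pos.le (integral_nonneg fun x => sq_nonneg _)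
  have h1 := h f hf hfs (by linarith)
  have h2 := h g hg hgs (by linarith)
  set a := ∫ x, gradSq3 f x
  set b := ∫ x, gradSq3 g x
  have ha : 0 ≤ a := integral_nonneg fun x => gradSq3_nonneg f x
  have hb : 0 ≤ b := integral_nonneg fun x => gradSq3_nonneg g x
  have hp : 1 ≤ 2 * π := by nlinarith [Real.pi_gt_three]
  have ha' : a * √a ≤ (2 * π * a + 2 * π * b) * √(2 * π * a + 2 * π * b) :=
    mul_sqrt_mono ha (by nlinarith)
  have hb' : b * √b ≤ (2 * π * a + 2 * π * b) * √(2 * π * a + 2 * π * b) :=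
    mul_sqrt_mono hb (by nlinarith)
  have hN : ∫ x, nonlin3 f g x ≤ 2 * ((∫ x, f x ^ 4) + ∫ x, g x ^ 4) := by
    rw [← integral_add hF.memL4 hG.memL4, ← integral_const_mul]
    refine integral_mono (integrable_nonlin hF.diff.continuous.aestronglyMeasurable
      hG.diff.continuous.aestronglyMeasurable hF.memL4 hG.memL4)
      ((hF.memL4.add hG.memL4).const_mul 2) fun x => ?_
    simp only [nonlin3]
    nlinarith [sq_nonneg (f x ^ 2 - g x ^ 2)]
  set S := (2 * π * a + 2 * π * b) * √(2 * π * a + 2 * π * b)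
  have h3 : ∫ x, nonlin3 f g x ≤ 4 * K * S := by nlinarith
  calc 2 * π * ∫ x, nonlin3 f g x ≤ 2 * π * (4 * K * S) := by gcongr
    _ = 8 * π * K * S := by ring

lemma l2R3_eq_iff {f : Pt3 → ℝ} : l2R3 f = 1 / √(2 * π) ↔ 2 * π * ∫ x, f x ^ 2 = 1 := by
  have h2 : 0 < 2 * π := two_pi_pos
  have hM : 0 ≤ ∫ x, f x ^ 2 := integral_nonneg fun x => sq_nonneg _
  rw [l2R3, ← Real.sqrt_one, ← Real.sqrt_div' _ h2.le, Real.sqrt_inj hM (by positivity),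
    eq_div_iff h2.ne', mul_comm]
  simp

lemma inS_one_iff {u : Pt → ℝ} : inS 1 u ↔ H1 u ∧ ∫ p in Dom, u p ^ 2 = 1 := by
  rw [inS, l2, Real.sqrt_eq_one]

lemma H1R3.lift {f : Pt3 → ℝ} (hf : H1R3 f) : H1 (lift f) where
  periodic _ _ := rfl
  diff p := (hasFDerivAt_lift (hf.diff p.1)).differentiableAt
  memL2 := integrableOn_lift hf.memL2
  memL4 := integrableOn_lift hf.memL4
  memGrad := by
    simpa [gradSq, gradSqX_lift (hf.diff _), grady_lift (hf.diff _)] using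
      integrableOn_lift hf.memGrad

lemma integral_sq_lift (f : Pt3 → ℝ) :
    ∫ p in Dom, lift f p ^ 2 = 2 * π * ∫ x, f x ^ 2 := integral_lift (f := fun x => f x ^ 2)

lemma integral_gradSqX_lift {f : Pt3 → ℝ} (hf : Differentiable ℝ f) :
    ∫ p in Dom, gradSqX (lift f) p = 2 * π * ∫ x, gradSq3 f x := by
  simp only [gradSqX_lift (hf _)]
  exact integral_lift

lemma integral_nonlin_lift (f g : Pt3 → ℝ) :
    ∫ p in Dom, nonlin (lift f) (lift g) p = 2 * π * ∫ x, nonlin3 f g x :=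
  integral_lift (f := nonlin3 f g)

lemma svirial_eq {u v : Pt → ℝ} (hu : H1 u) (hv : H1 v) :
    svirial u v = (∫ p in Dom, gradSqX u p) + (∫ p in Dom, gradSqX v p)
      - 3 / 4 * ∫ p in Dom, nonlin u v p := by
  rw [svirial, integral_add hu.integrable_gradSqX hv.integrable_gradSqX]

lemma Jfun_eq {μ : ℝ} {u v : Pt → ℝ} (hu : H1 u) (hv : H1 v) (hQ : svirial u v = 0) :
    Jfun μ u v = ((∫ p in Dom, gradSqX u p) + ∫ p in Dom, gradSqX v p) / 6
      + μ / 2 * ((∫ p in Dom, grady u p ^ 2) + ∫ p in Dom, grady v p ^ 2) := by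
  have h1 := hu.integrable_gradSqX
  have h2 := hv.integrable_gradSqX
  have h3 : IntegrableOn (fun p => μ * grady u p ^ 2) Dom := hu.integrable_grady_sq.const_mul μ
  have h4 : IntegrableOn (fun p => μ * grady v p ^ 2) Dom := hv.integrable_grady_sq.const_mul μ
  have h13 : IntegrableOn (fun p => gradSqX u p + μ * grady u p ^ 2) Dom := h1.add h3
  have h132 : IntegrableOn (fun p => gradSqX u p + μ * grady u p ^ 2 + gradSqX v p) Dom :=
    h13.add h2
  rw [svirial_eq hu hv] at hQ
  rw [Jfun, integral_add h132 h4, integral_add h13 h2, integral_add h1 h3, integral_const_mul,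
    integral_const_mul]
  linarith

lemma gradX_lower_bound {C κ : ℝ} {u v : Pt → ℝ} (hu : H1 u) (hv : H1 v)
    (hum : ∫ p in Dom, u p ^ 2 = 1) (hQ : svirial u v = 0)
    (h : ∫ p in Dom, nonlin u v p
      ≤ κ * (((∫ p in Dom, gradSqX u p) + ∫ p in Dom, gradSqX v p)
          * √((∫ p in Dom, gradSqX u p) + ∫ p in Dom, gradSqX v p))
        * (1 + C / κ ^ 2 * ((∫ p in Dom, grady u p ^ 2) + ∫ p in Dom, grady v p ^ 2))) :
    16 / 9 ≤ κ ^ 2 * ((∫ p in Dom, gradSqX u p) + ∫ p in Dom, gradSqX v p)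
        * (1 + C / κ ^ 2 * ((∫ p in Dom, grady u p ^ 2) + ∫ p in Dom, grady v p ^ 2)) ^ 2 := by
  rw [svirial_eq hu hv] at hQ
  set A := (∫ p in Dom, gradSqX u p) + ∫ p in Dom, gradSqX v p
  set B := (∫ p in Dom, grady u p ^ 2) + ∫ p in Dom, grady v p ^ 2
  set N := ∫ p in Dom, nonlin u v p with hN
  have hA0 : 0 ≤ A :=
    add_nonneg (integral_nonneg (gradSqX_nonneg _)) (integral_nonneg (gradSqX_nonneg _))
  have hN0 : N ≠ 0 := fun h0 => by
    have := integral_sq_eq_zero_of_nonlin (hu.integrable_nonlin hv) h0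
    rw [this] at hum
    exact zero_ne_one hum
  have hA : 0 < A := hA0.lt_of_ne fun h0 => hN0 (by linarith)
  have h1 : 4 / 3 ≤ κ * √A * (1 + C / κ ^ 2 * B) := by
    have : A * (4 / 3) ≤ A * (κ * √A * (1 + C / κ ^ 2 * B)) := by linarith
    exact le_of_mul_le_mul_left this hA
  calc (16 / 9 : ℝ) = (4 / 3) ^ 2 := by norm_num
    _ ≤ (κ * √A * (1 + C / κ ^ 2 * B)) ^ 2 := by gcongr
    _ = κ ^ 2 * √A ^ 2 * (1 + C / κ ^ 2 * B) ^ 2 := by ring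
    _ = _ := by rw [Real.sq_sqrt hA0]

lemma exists_lift_of_mem {c : ℝ} (hc : c ∈ mhatSet (1 / √(2 * π))) :
    ∃ f g : Pt3 → ℝ, H1R3 f ∧ H1R3 g ∧ inS 1 (lift f) ∧ inS 1 (lift g) ∧
      svirial (lift f) (lift g) = 0 ∧
      ((∫ p in Dom, gradSqX (lift f) p) + ∫ p in Dom, gradSqX (lift g) p) = 6 * (2 * π * c) ∧
      (∫ p in Dom, grady (lift f) p ^ 2) + (∫ p in Dom, grady (lift g) p ^ 2) = 0 := by
  obtain ⟨f, g, hf, hg, hfm, hgm, hQ, rfl⟩ := hc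
  have hA : ((∫ p in Dom, gradSqX (lift f) p) + ∫ p in Dom, gradSqX (lift g) p)
      = 2 * π * ∫ x, (gradSq3 f x + gradSq3 g x) := by
    rw [integral_gradSqX_lift hf.diff, integral_gradSqX_lift hg.diff, hf.integral_gradSq3_add hg,
      mul_add]
  refine ⟨f, g, hf, hg, inS_one_iff.2 ⟨hf.lift, ?_⟩, inS_one_iff.2 ⟨hg.lift, ?_⟩, ?_, ?_, ?_⟩
  · rw [integral_sq_lift, l2R3_eq_iff.1 hfm]
  · rw [integral_sq_lift, l2R3_eq_iff.1 hgm]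
  · rw [svirial_eq hf.lift hg.lift, hA, integral_nonlin_lift]
    unfold Qhat at hQ
    linear_combination 2 * π * hQ
  · rw [hA, Ihat_eq_of_Qhat_eq_zero hQ]
    ring
  · simp [grady_lift (hf.diff _), grady_lift (hg.diff _)]

/-- The limit level `2π m̂`. -/
def limitLevel : ℝ := 2 * π * mhat (1 / √(2 * π))

lemma gradSq3_pos_of_nonlin3_pos {f g : Pt3 → ℝ} (hf : H1R3 f) (hg : H1R3 g)
    (hm : 2 * π * (∫ x, f x ^ 2) + 2 * π * (∫ x, g x ^ 2) ≤ 2) (hN : 0 < ∫ x, nonlin3 f g x) :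
    0 < (∫ x, gradSq3 f x) + ∫ x, gradSq3 g x := by
  obtain ⟨κ, hκ, hGN⟩ := exists_gagliardoNirenberg
  have hA : 0 ≤ (∫ x, gradSq3 f x) + ∫ x, gradSq3 g x :=
    add_nonneg (integral_nonneg fun x => gradSq3_nonneg f x)
      (integral_nonneg fun x => gradSq3_nonneg g x)
  refine hA.lt_of_ne fun h => ?_
  obtain ⟨C, hC0, hC⟩ := exists_waveguide_inequality
  have := hC κ hκ hGN _ _ hf.lift hg.lift (by rwa [integral_sq_lift, integral_sq_lift])
  rw [integral_gradSqX_lift hf.diff, integral_gradSqX_lift hg.diff, integral_nonlin_lift,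
    ← mul_add, ← h] at this
  simp only [mul_zero, zero_mul] at this
  nlinarith [Real.pi_pos]

lemma mhatSet_nonempty : (mhatSet (1 / √(2 * π))).Nonempty := by
  let χ : ContDiffBump (0 : Pt3) := ⟨1, 2, one_pos, one_lt_two⟩
  have hχ : H1R3 χ := H1R3_of_contDiff χ.contDiff χ.hasCompactSupport
  have hpos : 0 < ∫ x, χ x ^ 2 := by
    refine (χ.continuous.pow 2).integral_pos_of_hasCompactSupport_nonneg_nonzero
      (hasCompactSupport_pow χ.hasCompactSupport two_ne_zero) (fun x => sq_nonneg _) (x := 0) ?_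
    rw [χ.one_of_mem_closedBall (by simp [χ])]
    simp
  have h2 := two_pi_pos
  set b := √(1 / (2 * π * ∫ x, χ x ^ 2))
  have hb : b ^ 2 = 1 / (2 * π * ∫ x, χ x ^ 2) := Real.sq_sqrt (by positivity)
  set f := dilate b 1 χ
  have hf : H1R3 f := hχ.dilate b one_pos
  have hfm : 2 * π * ∫ x, f x ^ 2 = 1 := by
    rw [integral_dilate_sq one_pos, hb]
    field_simp
  have hm : ∫ x, f x ^ 2 ≠ 0 := fun h0 => by simp [h0] at hfm
  have hN : 0 < ∫ x, nonlin3 f f x := by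
    refine (integral_nonneg fun x => nonlin3_nonneg f f x).lt_of_ne fun h0 => hm ?_
    exact integral_sq_eq_zero_of_nonlin (integrable_nonlin hf.diff.continuous.aestronglyMeasurable
      hf.diff.continuous.aestronglyMeasurable hf.memL4 hf.memL4) h0.symm
  have hA := gradSq3_pos_of_nonlin3_pos hf hf (by linarith) hN
  exact ⟨_, mem_mhatSet hf hf (l2R3_eq_iff.2 hfm) (l2R3_eq_iff.2 hfm) hA hN⟩

lemma mhat_pos : 0 < mhat (1 / √(2 * π)) := by
  obtain ⟨κ, hκ, hGN⟩ := exists_gagliardoNirenberg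
  obtain ⟨C, hC0, hC⟩ := exists_waveguide_inequality
  refine lt_of_lt_of_le (b := 16 / 9 / (κ ^ 2 * (6 * (2 * π)))) (by positivity)
    (le_csInf mhatSet_nonempty fun c hc => ?_)
  obtain ⟨f, g, hf, hg, hfS, hgS, hQ, hA, hB⟩ := exists_lift_of_mem hc
  have hfm := (inS_one_iff.1 hfS).2
  have hgm := (inS_one_iff.1 hgS).2
  have := gradX_lower_bound hf.lift hg.lift hfm hQ
    (hC κ hκ hGN _ _ hf.lift hg.lift (by linarith))
  rw [hA, hB] at this
  rw [div_le_iff₀ (by positivity)]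
  linarith

lemma limitLevel_pos : 0 < limitLevel := mul_pos two_pi_pos mhat_pos

lemma integral_nonlin3_eq_zero {f g : Pt3 → ℝ} (hf : H1R3 f) (hg : H1R3 g)
    (h : (∫ x, f x ^ 2) + ∫ x, g x ^ 2 = 0) : ∫ x, nonlin3 f g x = 0 := by
  have hMf : 0 ≤ ∫ x, f x ^ 2 := integral_nonneg fun x => sq_nonneg _
  have hMg : 0 ≤ ∫ x, g x ^ 2 := integral_nonneg fun x => sq_nonneg _
  have h1 : ∫ x, f x ^ 2 = 0 := by linarith
  have h2 : ∫ x, g x ^ 2 = 0 := by linarith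
  rw [integral_eq_zero_iff_of_nonneg (fun x => sq_nonneg _) hf.memL2] at h1
  rw [integral_eq_zero_iff_of_nonneg (fun x => sq_nonneg _) hg.memL2] at h2
  refine integral_eq_zero_of_ae ?_
  filter_upwards [h1, h2] with x hx hy
  have hx' : f x = 0 := by simpa using hx
  have hy' : g x = 0 := by simpa using hy
  simp [nonlin3, hx', hy']

lemma mhat_mul_sq_le {f g : Pt3 → ℝ} (hf : H1R3 f) (hg : H1R3 g)
    (hm : 2 * π * (∫ x, f x ^ 2) + 2 * π * (∫ x, g x ^ 2) ≤ 2) :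
    mhat (1 / √(2 * π)) * (∫ x, nonlin3 f g x) ^ 2
      ≤ 8 / 27 * ((∫ x, gradSq3 f x) + ∫ x, gradSq3 g x) ^ 3 := by
  have hA0 : 0 ≤ (∫ x, gradSq3 f x) + ∫ x, gradSq3 g x :=
    add_nonneg (integral_nonneg fun x => gradSq3_nonneg f x)
      (integral_nonneg fun x => gradSq3_nonneg g x)
  rcases (integral_nonneg (fun x => nonlin3_nonneg f g x) :
    0 ≤ ∫ x, nonlin3 f g x).eq_or_lt with hN | hN
  · rw [← hN]
    simp only [ne_eq, OfNat.ofNat_ne_zero, not_false_eq_true, zero_pow, mul_zero]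
    positivity
  have hA := gradSq3_pos_of_nonlin3_pos hf hg hm hN
  have hM0 : 0 ≤ (∫ x, f x ^ 2) + ∫ x, g x ^ 2 :=
    add_nonneg (integral_nonneg fun x => sq_nonneg _) (integral_nonneg fun x => sq_nonneg _)
  have hM : 0 < (∫ x, f x ^ 2) + ∫ x, g x ^ 2 :=
    hM0.lt_of_ne fun h => hN.ne' (integral_nonlin3_eq_zero hf hg h.symm)
  obtain ⟨f', g', hf', hg', hfm', hgm', hA', hN'⟩ := exists_equal_mass hf hg
  rw [← mul_add] at hm
  set M := (∫ x, f x ^ 2) + ∫ x, g x ^ 2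
  rw [← hA'] at hA ⊢
  rw [← hN'] at hN ⊢
  set b := √(1 / (π * M))
  have hb : b ^ 2 = 1 / (π * M) := Real.sq_sqrt (by positivity)
  have hb1 : 1 ≤ b ^ 2 := by
    rw [hb, le_div_iff₀ (by positivity)]
    linarith
  have hb0 : 0 < b ^ 2 := by linarith
  have hmass : ∀ w : Pt3 → ℝ, ∫ x, w x ^ 2 = M / 2 → l2R3 (dilate b 1 w) = 1 / √(2 * π) := by
    intro w hw
    rw [l2R3_eq_iff, integral_dilate_sq one_pos, hb, hw]
    field_simp
  have hAd : (∫ x, gradSq3 (dilate b 1 f') x) + ∫ x, gradSq3 (dilate b 1 g') x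
      = b ^ 2 * ((∫ x, gradSq3 f' x) + ∫ x, gradSq3 g' x) := by
    rw [integral_gradSq3_dilate one_pos hf'.diff, integral_gradSq3_dilate one_pos hg'.diff]
    ring
  have hNd : ∫ x, nonlin3 (dilate b 1 f') (dilate b 1 g') x
      = (b ^ 2) ^ 2 * ∫ x, nonlin3 f' g' x := by
    rw [integral_nonlin3_dilate one_pos]
    ring
  have hmem := mem_mhatSet (hf'.dilate b one_pos) (hg'.dilate b one_pos) (hmass f' hfm')
    (hmass g' hgm') (by rw [hAd]; positivity) (by rw [hNd]; positivity)
  have hle : mhat (1 / √(2 * π)) ≤ _ := csInf_le (bddBelow_mhatSet _) hmem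
  rw [hAd, hNd, le_div_iff₀ (by positivity)] at hle
  set A := (∫ x, gradSq3 f' x) + ∫ x, gradSq3 g' x
  set N := ∫ x, nonlin3 f' g' x
  set s := b ^ 2
  have h1 : s ^ 3 * (s * (mhat (1 / √(2 * π)) * N ^ 2)) ≤ s ^ 3 * (8 / 27 * A ^ 3) := by
    linarith
  have h2 := le_of_mul_le_mul_left h1 (by positivity)
  have h3 : 0 ≤ mhat (1 / √(2 * π)) * N ^ 2 := mul_nonneg mhat_pos.le (sq_nonneg _)
  nlinarith

lemma gagliardoNirenberg_sharp : GagliardoNirenberg √(8 / (27 * limitLevel)) := by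
  intro f g hf hg hfb hgb hm
  have hF := H1R3_of_contDiff hf (hasCompactSupport_of_norm_bounded hfb)
  have hG := H1R3_of_contDiff hg (hasCompactSupport_of_norm_bounded hgb)
  have hA0 : 0 ≤ (∫ x, gradSq3 f x) + ∫ x, gradSq3 g x :=
    add_nonneg (integral_nonneg fun x => gradSq3_nonneg f x)
      (integral_nonneg fun x => gradSq3_nonneg g x)
  have h := mhat_mul_sq_le hF hG hm
  have hT := limitLevel_pos
  have hl := mhat_pos
  rw [← mul_add]
  set A := (∫ x, gradSq3 f x) + ∫ x, gradSq3 g x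
  refine le_of_sq_le_sq ?_ (by positivity)
  rw [mul_pow √_, mul_pow (2 * π * A), Real.sq_sqrt (by positivity), Real.sq_sqrt (by positivity)]
  have hTd : limitLevel = 2 * π * mhat (1 / √(2 * π)) := rfl
  rw [div_mul_eq_mul_div, le_div_iff₀ (by positivity), hTd]
  have h2 : 8 * π ^ 3 * (27 * (mhat (1 / √(2 * π)) * (∫ x, nonlin3 f g x) ^ 2))
      ≤ 8 * π ^ 3 * (27 * (8 / 27 * A ^ 3)) := by gcongr
  linarith

/-- The single-mode oscillation `√2 cos(y) F(x)`. -/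
def wave (F : Pt3 → ℝ) (p : Pt) : ℝ := √2 * cos p.2 * F p.1

lemma hasFDerivAt_wave {F : Pt3 → ℝ} (hF : Differentiable ℝ F) (p : Pt) :
    HasFDerivAt (wave F) ((√2 * cos p.2) • (fderiv ℝ F p.1).comp (ContinuousLinearMap.fst ℝ Pt3 ℝ)
      + F p.1 • (√2 • (-sin p.2) • ContinuousLinearMap.snd ℝ Pt3 ℝ)) p := by
  have h1 : HasFDerivAt (fun p : Pt => F p.1) _ p := hasFDerivAt_lift (hF p.1)
  have h2 : HasFDerivAt (fun p : Pt => √2 * cos p.2) _ p :=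
    (hasFDerivAt_snd (p := p) (𝕜 := ℝ)).cos.const_mul √2
  exact h2.mul h1

lemma gradSqX_wave {F : Pt3 → ℝ} (hF : Differentiable ℝ F) (p : Pt) :
    gradSqX (wave F) p = 2 * cos p.2 ^ 2 * gradSq3 F p.1 := by
  have h2 : (√2 : ℝ) ^ 2 = 2 := Real.sq_sqrt zero_le_two
  simp only [gradSqX, gradSq3, grad3, gradx, (hasFDerivAt_wave hF p).fderiv, Finset.mul_sum]
  refine Finset.sum_congr rfl fun i _ => ?_
  have he : (ex i).1 = e3 i := rfl
  have he2 : (ex i).2 = 0 := rfl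
  simp [he, he2, mul_pow, h2]

lemma grady_wave {F : Pt3 → ℝ} (hF : Differentiable ℝ F) (p : Pt) :
    grady (wave F) p = -(√2 * sin p.2 * F p.1) := by
  simp only [grady, (hasFDerivAt_wave hF p).fderiv]
  simp [ey]
  ring

lemma integral_dom_mul (φ : ℝ → ℝ) (F : Pt3 → ℝ) :
    ∫ p : Pt in Dom, φ p.2 * F p.1 = (∫ y in (0 : ℝ)..2 * π, φ y) * ∫ x, F x := by
  rw [volume_restrict_dom, intervalIntegral.integral_of_le two_pi_pos.le,
    mul_comm (∫ y in Set.Ioc 0 (2 * π), φ y), ← integral_prod_mul]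
  simp only [mul_comm (F _)]

lemma integrableOn_dom_mul {φ : ℝ → ℝ} (hφ : Continuous φ) {F : Pt3 → ℝ} (hF : Integrable F) :
    IntegrableOn (fun p : Pt => φ p.2 * F p.1) Dom := by
  rw [IntegrableOn, volume_restrict_dom]
  have h : Integrable φ (volume.restrict (Set.Ioc (0 : ℝ) (2 * π))) := hφ.integrableOn_Ioc
  simpa only [mul_comm] using hF.mul_prod h

lemma wave_sq (F : Pt3 → ℝ) (p : Pt) : wave F p ^ 2 = 2 * cos p.2 ^ 2 * F p.1 ^ 2 := by
  rw [wave, mul_pow, mul_pow, Real.sq_sqrt zero_le_two]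

lemma grady_wave_sq {F : Pt3 → ℝ} (hF : Differentiable ℝ F) (p : Pt) :
    grady (wave F) p ^ 2 = 2 * sin p.2 ^ 2 * F p.1 ^ 2 := by
  rw [grady_wave hF, neg_sq, mul_pow, mul_pow, Real.sq_sqrt zero_le_two]

lemma H1R3.wave {F : Pt3 → ℝ} (hF : H1R3 F) : H1 (wave F) where
  periodic x y := by simp [Waveguide.wave]
  diff p := (hasFDerivAt_wave hF.diff p).differentiableAt
  memL2 := by
    simp only [wave_sq]
    exact integrableOn_dom_mul (φ := fun y => 2 * cos y ^ 2) (by fun_prop) hF.memL2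
  memL4 := by
    have e : ∀ p, Waveguide.wave F p ^ 4 = 4 * cos p.2 ^ 4 * F p.1 ^ 4 := fun p => by
      rw [show Waveguide.wave F p ^ 4 = (Waveguide.wave F p ^ 2) ^ 2 by ring, wave_sq]; ring
    simp only [e]
    exact integrableOn_dom_mul (φ := fun y => 4 * cos y ^ 4) (by fun_prop) hF.memL4
  memGrad := by
    simp only [gradSq, gradSqX_wave hF.diff, grady_wave_sq hF.diff]
    exact (integrableOn_dom_mul (φ := fun y => 2 * cos y ^ 2) (by fun_prop) hF.memGrad).add
      (integrableOn_dom_mul (φ := fun y => 2 * sin y ^ 2) (by fun_prop) hF.memL2)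

lemma integral_two_cos_sq : ∫ y in (0 : ℝ)..2 * π, 2 * cos y ^ 2 = 2 * π := by
  rw [intervalIntegral.integral_const_mul, integral_cos_sq]
  simp

lemma integral_two_sin_sq : ∫ y in (0 : ℝ)..2 * π, 2 * sin y ^ 2 = 2 * π := by
  rw [intervalIntegral.integral_const_mul, integral_sin_sq]
  simp

lemma integral_four_cos_pow_four : ∫ y in (0 : ℝ)..2 * π, 4 * cos y ^ 4 = 3 * π := by
  rw [intervalIntegral.integral_const_mul, integral_cos_pow, integral_cos_sq]
  simp
  ring

lemma integral_wave_sq (F : Pt3 → ℝ) : ∫ p in Dom, wave F p ^ 2 = 2 * π * ∫ x, F x ^ 2 := by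
  simp only [wave_sq]
  rw [integral_dom_mul (fun y => 2 * cos y ^ 2) fun x => F x ^ 2, integral_two_cos_sq]

lemma integral_grady_wave_sq {F : Pt3 → ℝ} (hF : Differentiable ℝ F) :
    ∫ p in Dom, grady (wave F) p ^ 2 = 2 * π * ∫ x, F x ^ 2 := by
  simp only [grady_wave_sq hF]
  rw [integral_dom_mul (fun y => 2 * sin y ^ 2) fun x => F x ^ 2, integral_two_sin_sq]

lemma integral_gradSqX_wave {F : Pt3 → ℝ} (hF : Differentiable ℝ F) :
    ∫ p in Dom, gradSqX (wave F) p = 2 * π * ∫ x, gradSq3 F x := by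
  simp only [gradSqX_wave hF]
  rw [integral_dom_mul (fun y => 2 * cos y ^ 2) fun x => gradSq3 F x, integral_two_cos_sq]

lemma integral_nonlin_wave (F G : Pt3 → ℝ) :
    ∫ p in Dom, nonlin (wave F) (wave G) p = 3 * π * ∫ x, nonlin3 F G x := by
  have e : ∀ p, nonlin (wave F) (wave G) p = 4 * cos p.2 ^ 4 * nonlin3 F G p.1 := fun p => by
    have : nonlin (wave F) (wave G) p = (wave F p ^ 2 + wave G p ^ 2) ^ 2 := by
      unfold nonlin; ring
    rw [this, wave_sq, wave_sq, nonlin3]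
    ring
  simp only [e]
  rw [integral_dom_mul (fun y => 4 * cos y ^ 4) fun x => nonlin3 F G x, integral_four_cos_pow_four]

/-- The admissible energies in the definition of `m1`. -/
def m1Set (μ : ℝ) : Set ℝ :=
  {c | ∃ u v : Pt → ℝ, inS 1 u ∧ inS 1 v ∧ svirial u v = 0 ∧ Jfun μ u v = c}

lemma wave_mem_m1Set {c μ : ℝ} (hc : c ∈ mhatSet (1 / √(2 * π))) :
    4 / 9 * (2 * π * c) + μ ∈ m1Set μ := by
  obtain ⟨f, g, hf, hg, hfm, hgm, hQ, rfl⟩ := hc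
  have hτ : (0 : ℝ) < 2 / 3 := by norm_num
  set b : ℝ := √((2 / 3) ^ 3)
  have hb2 : b ^ 2 = (2 / 3) ^ 3 := Real.sq_sqrt (by positivity)
  have hb4 : b ^ 4 = (2 / 3) ^ 6 := by rw [show b ^ 4 = (b ^ 2) ^ 2 by ring, hb2]; ring
  have hF := hf.dilate b hτ
  have hG := hg.dilate b hτ
  have hm : ∀ w : Pt3 → ℝ, l2R3 w = 1 / √(2 * π) →
      2 * π * ∫ x, dilate b (2 / 3) w x ^ 2 = 1 := fun w hw => by
    rw [integral_dilate_sq hτ, hb2, div_self (by positivity), one_mul, l2R3_eq_iff.1 hw]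
  have hA : ∀ w : Pt3 → ℝ, Differentiable ℝ w →
      ∫ x, gradSq3 (dilate b (2 / 3) w) x = 4 / 9 * ∫ x, gradSq3 w x := fun w hw => by
    rw [integral_gradSq3_dilate hτ hw, hb2]
    norm_num
  have hN : ∫ x, nonlin3 (dilate b (2 / 3) f) (dilate b (2 / 3) g) x
      = 8 / 27 * ∫ x, nonlin3 f g x := by
    rw [integral_nonlin3_dilate hτ, hb4]
    norm_num
  have hI := Ihat_eq_of_Qhat_eq_zero hQ
  rw [hf.integral_gradSq3_add hg] at hI
  rw [Qhat, hf.integral_gradSq3_add hg] at hQ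
  have hQ' : svirial (wave (dilate b (2 / 3) f)) (wave (dilate b (2 / 3) g)) = 0 := by
    rw [svirial_eq hF.wave hG.wave, integral_gradSqX_wave hF.diff, integral_gradSqX_wave hG.diff,
      integral_nonlin_wave, hN, hA f hf.diff, hA g hg.diff]
    linear_combination (8 / 9 * π) * hQ
  refine ⟨_, _, inS_one_iff.2 ⟨hF.wave, ?_⟩, inS_one_iff.2 ⟨hG.wave, ?_⟩, hQ', ?_⟩
  · rw [integral_wave_sq, hm f hfm]
  · rw [integral_wave_sq, hm g hgm]
  · rw [Jfun_eq hF.wave hG.wave hQ', integral_gradSqX_wave hF.diff, integral_gradSqX_wave hG.diff,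
      integral_grady_wave_sq hF.diff, integral_grady_wave_sq hG.diff, hm f hfm, hm g hgm,
      hA f hf.diff, hA g hg.diff, hI]
    ring

lemma lift_mem_m1Set {c μ : ℝ} (hc : c ∈ mhatSet (1 / √(2 * π))) : 2 * π * c ∈ m1Set μ := by
  obtain ⟨f, g, hf, hg, hfS, hgS, hQ, hA, hB⟩ := exists_lift_of_mem hc
  refine ⟨lift f, lift g, hfS, hgS, hQ, ?_⟩
  rw [Jfun_eq hf.lift hg.lift hQ, hA, hB]
  ring

lemma integral_gradSqX_add_nonneg (u v : Pt → ℝ) :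
    0 ≤ (∫ p in Dom, gradSqX u p) + ∫ p in Dom, gradSqX v p :=
  add_nonneg (integral_nonneg (gradSqX_nonneg _)) (integral_nonneg (gradSqX_nonneg _))

lemma integral_grady_sq_add_nonneg (u v : Pt → ℝ) :
    0 ≤ (∫ p in Dom, grady u p ^ 2) + ∫ p in Dom, grady v p ^ 2 :=
  add_nonneg (integral_nonneg fun _ => sq_nonneg _) (integral_nonneg fun _ => sq_nonneg _)

lemma bddBelow_m1Set {μ : ℝ} (hμ : 0 < μ) : BddBelow (m1Set μ) := by
  refine ⟨0, ?_⟩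
  rintro _ ⟨u, v, hu, hv, hQ, rfl⟩
  rw [Jfun_eq hu.1 hv.1 hQ]
  have h1 := integral_gradSqX_add_nonneg u v
  have h2 := integral_grady_sq_add_nonneg u v
  positivity

lemma m1Set_nonempty (μ : ℝ) : (m1Set μ).Nonempty :=
  let ⟨_, hc⟩ := mhatSet_nonempty
  ⟨_, lift_mem_m1Set hc⟩

lemma m1_le {μ : ℝ} (hμ : 0 < μ) {u v : Pt → ℝ} (hu : inS 1 u) (hv : inS 1 v)
    (hQ : svirial u v = 0) : m1 μ ≤ Jfun μ u v :=
  csInf_le (bddBelow_m1Set hμ) ⟨u, v, hu, hv, hQ, rfl⟩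

lemma m1_le_limitLevel {μ : ℝ} (hμ : 0 < μ) : m1 μ ≤ limitLevel := by
  have h2 := two_pi_pos
  rw [limitLevel, ← div_le_iff₀' h2]
  refine le_csInf mhatSet_nonempty fun c hc => ?_
  rw [div_le_iff₀' h2]
  exact csInf_le (bddBelow_m1Set hμ) (lift_mem_m1Set hc)

lemma m1_mono {μ μ' : ℝ} (hμ : 0 < μ) (h : μ ≤ μ') : m1 μ ≤ m1 μ' := by
  refine le_csInf (m1Set_nonempty μ') ?_
  rintro _ ⟨u, v, hu, hv, hQ, rfl⟩
  refine (m1_le hμ hu hv hQ).trans ?_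
  rw [Jfun_eq hu.1 hv.1 hQ, Jfun_eq hu.1 hv.1 hQ]
  have h2 := integral_grady_sq_add_nonneg u v
  gcongr

lemma exists_m1_lt_limitLevel : ∃ μ : ℝ, 0 < μ ∧ m1 μ < limitLevel := by
  have hT := limitLevel_pos
  refine ⟨limitLevel / 9, by positivity, ?_⟩
  obtain ⟨c, hc, hlt⟩ := exists_lt_of_csInf_lt mhatSet_nonempty
    (show mhat (1 / √(2 * π)) < 2 * mhat (1 / √(2 * π)) by linarith [mhat_pos])
  refine (csInf_le (bddBelow_m1Set (by positivity)) (wave_mem_m1Set hc)).trans_lt ?_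
  have h1 : 2 * π * c < 2 * π * (2 * mhat (1 / √(2 * π))) := by
    have := Real.pi_pos
    gcongr
  have h2 : limitLevel = 2 * π * mhat (1 / √(2 * π)) := rfl
  linarith

lemma exists_m1_eq_limitLevel : ∃ μ : ℝ, 0 < μ ∧ m1 μ = limitLevel := by
  obtain ⟨C, hC0, hC⟩ := exists_waveguide_inequality
  have hT := limitLevel_pos
  set κ := √(8 / (27 * limitLevel)) with hκd
  have hκ : 0 < κ := by positivity
  have hκ2 : κ ^ 2 = 8 / (27 * limitLevel) := Real.sq_sqrt (by positivity)
  set t := C / κ ^ 2 with ht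
  have ht0 : 0 ≤ t := by positivity
  refine ⟨4 * limitLevel * t + 1, by positivity,
    (m1_le_limitLevel (by positivity)).antisymm (le_csInf (m1Set_nonempty _) ?_)⟩
  rintro _ ⟨u, v, hu, hv, hQ, rfl⟩
  rw [inS_one_iff] at hu hv
  have h := gradX_lower_bound hu.1 hv.1 hu.2 hQ
    (hC κ hκ gagliardoNirenberg_sharp u v hu.1 hv.1 (by linarith [hu.2, hv.2]))
  rw [Jfun_eq hu.1 hv.1 hQ]
  rw [← ht, hκ2, div_mul_eq_mul_div, div_mul_eq_mul_div, le_div_iff₀ (by positivity)] at h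
  have hB := integral_grady_sq_add_nonneg u v
  set A := (∫ p in Dom, gradSqX u p) + ∫ p in Dom, gradSqX v p
  set B := (∫ p in Dom, grady u p ^ 2) + ∫ p in Dom, grady v p ^ 2
  have hs : 0 ≤ t * B := by positivity
  have h1 : 6 * limitLevel * (1 - 2 * (t * B)) * (1 + t * B) ^ 2 ≤ A * (1 + t * B) ^ 2 := by
    have : (1 - 2 * (t * B)) * (1 + t * B) ^ 2 ≤ 1 := by nlinarith [pow_nonneg hs 2, pow_nonneg hs 3]
    nlinarith
  have h2 := le_of_mul_le_mul_right h1 (by positivity)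
  linarith

lemma eq_of_grady_ae_zero {u : Pt → ℝ} (hu : Differentiable ℝ u) {x : Pt3}
    (h : ∀ᵐ y : ℝ, grady u (x, y) = 0) (y : ℝ) : u (x, y) = u (x, 0) := by
  have hi : IntervalIntegrable (fun y => grady u (x, y)) volume 0 y :=
    (intervalIntegrable_const (c := (0 : ℝ))).congr_ae
      (ae_restrict_of_ae (by filter_upwards [h] with y hy using hy.symm))
  have h1 := intervalIntegral.integral_eq_sub_of_hasDerivAt
    (fun y _ => hasDerivAt_slice_y hu x y) hi
  have h2 : ∫ y in (0 : ℝ)..y, grady u (x, y) = 0 := by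
    rw [intervalIntegral.integral_congr_ae (g := fun _ => (0 : ℝ))
      (by filter_upwards [h] with y hy _ using hy)]
    simp
  linarith

lemma Yindep.eq_lift {u : Pt → ℝ} (hu : Differentiable ℝ u) (h : Yindep u) :
    u = lift fun x => u (x, 0) := by
  have h1 : ∀ᵐ x : Pt3, ∀ᵐ y : ℝ, grady u (x, y) = 0 := by
    rw [Yindep, Measure.volume_eq_prod] at h
    exact Measure.ae_ae_of_ae_prod h
  funext p
  obtain ⟨x, y⟩ := p
  have hc := hu.continuous
  have h2 : (fun x => u (x, y)) =ᵐ[volume] fun x => u (x, 0) := by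
    filter_upwards [h1] with x hx using eq_of_grady_ae_zero hu hx y
  exact congrFun ((Continuous.ae_eq_iff_eq volume (by fun_prop) (by fun_prop)).1 h2) x

lemma integrable_of_integrableOn_lift {F : Pt3 → ℝ}
    (h : IntegrableOn (fun p : Pt => F p.1) Dom) : Integrable F := by
  rw [IntegrableOn, volume_restrict_dom] at h
  have : NeZero (volume.restrict (Set.Ioc (0 : ℝ) (2 * π))) := ⟨by simp [Real.pi_pos]⟩
  obtain ⟨y, hy⟩ := h.prod_left_ae.exists
  exact hy

lemma H1R3_of_lift {f : Pt3 → ℝ} (h : H1 (lift f)) : H1R3 f := by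
  have hd : Differentiable ℝ f := h.diff.comp (g := lift f) (f := fun x : Pt3 => (x, (0 : ℝ)))
    (by fun_prop)
  refine ⟨hd, integrable_of_integrableOn_lift h.memL2, integrable_of_integrableOn_lift ?_,
    integrable_of_integrableOn_lift h.memL4⟩
  simpa [gradSq, gradSqX_lift (hd _), grady_lift (hd _)] using h.memGrad

lemma limitLevel_le_of_Yindep {μ : ℝ} {u v : Pt → ℝ} (hu : inS 1 u) (hv : inS 1 v)
    (hQ : svirial u v = 0) (hyu : Yindep u) (hyv : Yindep v) : limitLevel ≤ Jfun μ u v := by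
  obtain ⟨f, rfl⟩ : ∃ f, u = lift f := ⟨_, hyu.eq_lift hu.1.diff⟩
  obtain ⟨g, rfl⟩ : ∃ g, v = lift g := ⟨_, hyv.eq_lift hv.1.diff⟩
  have hf := H1R3_of_lift hu.1
  have hg := H1R3_of_lift hv.1
  rw [inS_one_iff, integral_sq_lift] at hu hv
  have hJ := Jfun_eq (μ := μ) hu.1 hv.1 hQ
  rw [svirial_eq hu.1 hv.1, integral_gradSqX_lift hf.diff, integral_gradSqX_lift hg.diff,
    integral_nonlin_lift] at hQ
  rw [integral_gradSqX_lift hf.diff, integral_gradSqX_lift hg.diff] at hJ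
  have hQ3 : Qhat f g = 0 := by
    rw [Qhat, hf.integral_gradSq3_add hg]
    have h2 := two_pi_pos
    have : 2 * π * ((∫ x, gradSq3 f x) + (∫ x, gradSq3 g x) - 3 / 4 * ∫ x, nonlin3 f g x) = 0 := by
      linear_combination hQ
    exact (mul_eq_zero.1 this).resolve_left h2.ne'
  have hmem : Ihat f g ∈ mhatSet (1 / √(2 * π)) :=
    ⟨f, g, hf, hg, l2R3_eq_iff.2 hu.2, l2R3_eq_iff.2 hv.2, hQ3, rfl⟩
  have hle : mhat (1 / √(2 * π)) ≤ Ihat f g := csInf_le (bddBelow_mhatSet _) hmem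
  rw [Ihat_eq_of_Qhat_eq_zero hQ3, hf.integral_gradSq3_add hg] at hle
  rw [hJ, limitLevel]
  simp only [grady_lift (hf.diff _), grady_lift (hg.diff _)]
  have := mul_le_mul_of_nonneg_left hle two_pi_pos.le
  simp only [ne_eq, OfNat.ofNat_ne_zero, not_false_eq_true, zero_pow, integral_zero, add_zero,
    mul_zero]
  linarith

lemma ae_of_ae_dom {F : Pt → ℝ} (hF : PeriodicY F)
    (h : ∀ᵐ p ∂(volume.restrict Dom), F p = 0) : ∀ᵐ p : Pt, F p = 0 := by
  rw [ae_restrict_iff' measurableSet_dom] at h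
  have hn : ∀ᵐ p : Pt, ∀ n : ℤ, p + (0, n • (2 * π)) ∈ Dom → F (p + (0, n • (2 * π))) = 0 :=
    ae_all_iff.2 fun n =>
      (measurePreserving_add_right volume ((0, n • (2 * π)) : Pt)).quasiMeasurePreserving.ae h
  filter_upwards [hn] with p hp
  obtain ⟨n, hn, -⟩ := existsUnique_add_zsmul_mem_Ioc two_pi_pos p.2 0
  have h1 := hp n ⟨Set.mem_univ _, by simpa using hn⟩
  have h2 := hF.zsmul n p.1 p.2
  have e : p + (0, n • (2 * π)) = (p.1, n • (2 * π) + p.2) :=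
    Prod.ext (add_zero _) (add_comm _ _)
  rw [← h1, e]
  exact h2.symm

lemma Yindep_of_integral_eq_zero {u : Pt → ℝ} (hu : H1 u)
    (h : ∫ p in Dom, grady u p ^ 2 = 0) : Yindep u := by
  rw [integral_eq_zero_iff_of_nonneg (fun p => sq_nonneg _) hu.integrable_grady_sq] at h
  refine ae_of_ae_dom (hu.periodic.fderiv_apply ey) ?_
  filter_upwards [h] with p hp
  exact pow_eq_zero_iff two_ne_zero |>.1 hp

/-- there is a threshold `μ*` separating the regime where minimizers of
`m_{1,μ}` depend on `y` (and `m_{1,μ} < 2π m̂_{1/√(2π)}`) from the regime where they are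
`y`-independent (and `m_{1,μ} = 2π m̂_{1/√(2π)}`). -/
theorem parameter_threshold_for_y_dependence :
    ∃ μstar : ℝ, 0 < μstar ∧
      (∀ μ : ℝ, 0 < μ → μ < μstar →
        m1 μ < 2 * π * mhat (1 / Real.sqrt (2 * π)) ∧
        ∀ u v : Pt → ℝ, isMinimizerJ μ u v → ¬ (Yindep u ∧ Yindep v)) ∧
      (∀ μ : ℝ, μstar < μ →
        m1 μ = 2 * π * mhat (1 / Real.sqrt (2 * π)) ∧
        ∀ u v : Pt → ℝ, isMinimizerJ μ u v → Yindep u ∧ Yindep v) := by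
  obtain ⟨μ₀, hμ₀, hlt⟩ := exists_m1_lt_limitLevel
  obtain ⟨μ₁, hμ₁, heq⟩ := exists_m1_eq_limitLevel
  set S := {μ : ℝ | 0 < μ ∧ m1 μ = limitLevel} with hS
  have hlow : ∀ μ ∈ S, μ₀ ≤ μ := fun μ hμ => by
    by_contra! h
    have := m1_mono hμ.1 h.le
    rw [hμ.2] at this
    exact this.not_gt hlt
  have hne : S.Nonempty := ⟨μ₁, hμ₁, heq⟩
  refine ⟨sInf S, hμ₀.trans_le (le_csInf hne hlow), fun μ hμ hμs => ?_, fun μ hμs => ?_⟩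
  · have h1 : m1 μ < limitLevel := (m1_le_limitLevel hμ).lt_of_ne fun h =>
      hμs.not_ge (csInf_le ⟨μ₀, hlow⟩ ⟨hμ, h⟩)
    refine ⟨h1, fun u v ⟨hu, hv, hQ, hJ⟩ ⟨hyu, hyv⟩ => ?_⟩
    have := limitLevel_le_of_Yindep (μ := μ) hu hv hQ hyu hyv
    rw [hJ] at this
    exact this.not_gt h1
  · obtain ⟨ν, ⟨hν, hνT⟩, hνμ⟩ := exists_lt_of_csInf_lt hne hμs
    have h1 : m1 μ = limitLevel :=
      (m1_le_limitLevel (hν.trans hνμ)).antisymm (hνT ▸ m1_mono hν hνμ.le)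
    refine ⟨h1, fun u v ⟨hu, hv, hQ, hJ⟩ => ?_⟩
    have h2 := m1_le hν hu hv hQ
    rw [h1, Jfun_eq hu.1 hv.1 hQ] at hJ
    rw [hνT, Jfun_eq hu.1 hv.1 hQ] at h2
    have h3 : 0 ≤ ∫ p in Dom, grady u p ^ 2 := integral_nonneg fun _ => sq_nonneg _
    have h4 : 0 ≤ ∫ p in Dom, grady v p ^ 2 := integral_nonneg fun _ => sq_nonneg _
    have h5 : (∫ p in Dom, grady u p ^ 2) + (∫ p in Dom, grady v p ^ 2) ≤ 0 := by
      by_contra! h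
      nlinarith
    exact ⟨Yindep_of_integral_eq_zero hu.1 (by linarith),
      Yindep_of_integral_eq_zero hv.1 (by linarith)⟩

end Waveguide
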